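/- arXiv:2104.02670 — 2 statements merged into one kernel-verified Lean document; each statement's English description precedes it below -/
import Mathlib

section
/- Let φ be a Drinfeld module of rank r over 𝕂 given by φ_t = θ + A_1 τ + ⋯ + A_r τ^r. Let x_1, …, x_r be a strict 𝔽_q-basis of φ[t], and suppose N ≥ 1 and ξ_1, …, ξ_r ∈ φ[t^N] satisfy, for each j: |ξ_j| < R_φ; φ_{t^{N−1}}(ξ_j) = x_j; and deg φ_{t^{N−1}}(ξ_j) > deg φ_{t^{N−2}}(ξ_j) > ⋯ > deg φ_t(ξ_j) > deg ξ_j. Define h_j := φ_{t^{N−1}}(ξ_j) + φ_{t^{N−2}}(ξ_j) t + ⋯ + ξ_j t^{N−1} ∈ 𝕂[t] and B := (h_j^{(i−1)})_{1≤i,j≤r} ∈ Mat_r(𝕂[t]). Then B ∈ GL_r(𝕋) and ‖B^{−1} Θ^{−1} B^{(1)} − I‖ < 1, where I is the r×r identity matrix. -/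
open Filter

set_option maxHeartbeats 1000000
set_option synthInstance.maxHeartbeats 400000

noncomputable section

namespace DrinfeldRAT

variable (𝕂 : Type) [NontriviallyNormedField 𝕂]

/-- `deg x := log_q ‖x‖`. -/
def degK (q : ℕ) (x : 𝕂) : ℝ := Real.logb q ‖x‖

/-- The action of `φ_t` on `𝕂`: `φ_t(x) = θ x + A_1 x^q + ⋯ + A_r x^{q^r}`. -/
def phiT (q r : ℕ) (θ : 𝕂) (A : ℕ → 𝕂) (x : 𝕂) : 𝕂 :=
  θ * x + ∑ i ∈ Finset.Icc 1 r, A i * x ^ q ^ i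

/-- Membership in `N(φ) = {1 ≤ i ≤ r : A_i ≠ 0}`. -/
def inNphi (r : ℕ) (A : ℕ → 𝕂) (i : ℕ) : Prop := 1 ≤ i ∧ i ≤ r ∧ A i ≠ 0

/-- `μ_n = (deg A_n − q^n)/(q^n − 1)`. -/
def muPhi (q : ℕ) (A : ℕ → 𝕂) (n : ℕ) : ℝ :=
  (degK 𝕂 q (A n) - (q : ℝ) ^ n) / ((q : ℝ) ^ n - 1)

/-- `m` is the smallest index in `N(φ)` at which `μ` is maximal on `N(φ)`. -/
def IsMuIndex (q r : ℕ) (A : ℕ → 𝕂) (m : ℕ) : Prop :=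
  inNphi 𝕂 r A m ∧ (∀ i, inNphi 𝕂 r A i → muPhi 𝕂 q A i ≤ muPhi 𝕂 q A m) ∧
    ∀ m', inNphi 𝕂 r A m' → (∀ i, inNphi 𝕂 r A i → muPhi 𝕂 q A i ≤ muPhi 𝕂 q A m') → m ≤ m'

/-- `R_φ = q^{−μ_m}` (a real power). -/
def Rphi (q : ℕ) (A : ℕ → 𝕂) (m : ℕ) : ℝ := (q : ℝ) ^ (-(muPhi 𝕂 q A m))

/-- The coefficient of `x^{q^n}` in `φ_t(x)`, with `A₀ = θ`. -/
def Acoef (θ : 𝕂) (A : ℕ → 𝕂) (n : ℕ) : 𝕂 := if n = 0 then θ else A n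

/-- Data of the Newton polygon of `φ_t(x)`: vertices `(q^{d_j}, −deg A_{d_j})`,
`0 = d_0 < d_1 < ⋯ < d_s = r`, with strictly increasing edge slopes `λ_1 < ⋯ < λ_s`,
such that every point `(q^n, −deg A_n)` (for `A_n ≠ 0`, including `n = 0`) lies on or
above each edge line (lower convex hull). -/
structure NewtonData (q r : ℕ) (θ : 𝕂) (A : ℕ → 𝕂) where
  s : ℕ
  d : ℕ → ℕ
  lam : ℕ → ℝ
  s_pos : 0 < s
  d_zero : d 0 = 0
  d_last : d s = r
  d_mono : ∀ j < s, d j < d (j + 1)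
  vertex_ne : ∀ j, 1 ≤ j → j ≤ s → A (d j) ≠ 0
  slope_eq : ∀ j, 1 ≤ j → j ≤ s →
    lam j = (degK 𝕂 q (Acoef 𝕂 θ A (d (j - 1))) - degK 𝕂 q (Acoef 𝕂 θ A (d j))) /
      ((q : ℝ) ^ d j - (q : ℝ) ^ d (j - 1))
  lam_mono : ∀ j, 1 ≤ j → j + 1 ≤ s → lam j < lam (j + 1)
  hull : ∀ n ≤ r, Acoef 𝕂 θ A n ≠ 0 → ∀ j, 1 ≤ j → j ≤ s →
    lam j * ((q : ℝ) ^ n - (q : ℝ) ^ d j) + (-(degK 𝕂 q (Acoef 𝕂 θ A (d j)))) ≤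
      -(degK 𝕂 q (Acoef 𝕂 θ A n))

/-- `x 0, …, x (r−1)` is an `𝔽_q`-basis of `φ[t]` (`𝔽_q ⊆ 𝕂` is the set of `c` with `c^q = c`). -/
def IsFqBasis (q r : ℕ) (θ : 𝕂) (A : ℕ → 𝕂) (x : Fin r → 𝕂) : Prop :=
  (∀ j, phiT 𝕂 q r θ A (x j) = 0) ∧
    ∀ y, phiT 𝕂 q r θ A y = 0 →
      ∃! c : Fin r → 𝕂, (∀ j, c j ^ q = c j) ∧ y = ∑ j, c j * x j

/-- Strictness of a basis of `φ[t]` with respect to Newton polygon data: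
`deg x_j = λ_k` for `d_{k−1} < j ≤ d_k` (here `x` is indexed from `0`). -/
def IsStrict (q r : ℕ) (θ : 𝕂) (A : ℕ → 𝕂) (ND : NewtonData 𝕂 q r θ A)
    (x : Fin r → 𝕂) : Prop :=
  ∀ k, 1 ≤ k → k ≤ ND.s → ∀ j : Fin r, ND.d (k - 1) ≤ (j : ℕ) → (j : ℕ) < ND.d k →
    degK 𝕂 q (x j) = ND.lam k

/-- The conditions of Proposition `good-xi` on `ξ_1, …, ξ_r ∈ φ[t^N]`:
`|ξ_j| < R_φ`, `φ_{t^{N−1}}(ξ_j) = x_j`, and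
`deg φ_{t^{N−1}}(ξ_j) > ⋯ > deg φ_t(ξ_j) > deg ξ_j`. -/
def GoodXi (q r N : ℕ) (θ : 𝕂) (A : ℕ → 𝕂) (m : ℕ) (x ξ : Fin r → 𝕂) : Prop :=
  ∀ j, (phiT 𝕂 q r θ A)^[N] (ξ j) = 0 ∧
    ‖ξ j‖ < Rphi 𝕂 q A m ∧
    (phiT 𝕂 q r θ A)^[N - 1] (ξ j) = x j ∧
    ∀ i, i + 1 ≤ N - 1 →
      degK 𝕂 q ((phiT 𝕂 q r θ A)^[i] (ξ j)) < degK 𝕂 q ((phiT 𝕂 q r θ A)^[i + 1] (ξ j))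

/-- Gauss norm of a power series. -/
def gnorm (f : PowerSeries 𝕂) : ℝ := ⨆ i : ℕ, ‖PowerSeries.coeff i f‖

/-- Membership in the Tate algebra `𝕋`: coefficients tend to `0`. -/
def IsTate (f : PowerSeries 𝕂) : Prop :=
  Tendsto (fun i => ‖PowerSeries.coeff i f‖) atTop (nhds 0)

/-- `n`-th Frobenius twist of a power series: coefficients raised to the `q^n` power. -/
def twist (q n : ℕ) (f : PowerSeries 𝕂) : PowerSeries 𝕂 :=
  PowerSeries.mk fun i => PowerSeries.coeff i f ^ q ^ n

/-- Entrywise Frobenius twist of a matrix of power series. -/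
def twistM {r : ℕ} (q n : ℕ) (M : Matrix (Fin r) (Fin r) (PowerSeries 𝕂)) :
    Matrix (Fin r) (Fin r) (PowerSeries 𝕂) :=
  Matrix.of fun i j => twist 𝕂 q n (M i j)

/-- Gauss norm of a matrix: maximum of the Gauss norms of the entries. -/
def mnorm {r : ℕ} (M : Matrix (Fin r) (Fin r) (PowerSeries 𝕂)) : ℝ :=
  ⨆ p : Fin r × Fin r, gnorm 𝕂 (M p.1 p.2)

/-- Membership in `GL_r(𝕋)`: all entries in `𝕋` and two-sided inverse with entries in `𝕋`. -/
def MemGLT {r : ℕ} (M : Matrix (Fin r) (Fin r) (PowerSeries 𝕂)) : Prop :=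
  (∀ i j, IsTate 𝕂 (M i j)) ∧
    ∃ C : Matrix (Fin r) (Fin r) (PowerSeries 𝕂),
      (∀ i j, IsTate 𝕂 (C i j)) ∧ M * C = 1 ∧ C * M = 1

/-- The matrix `Θ`, with entries viewed in `𝕂[[t]]`. -/
def ThetaPS (r : ℕ) (θ : 𝕂) (A : ℕ → 𝕂) : Matrix (Fin r) (Fin r) (PowerSeries 𝕂) :=
  Matrix.of fun i j =>
    if (i : ℕ) + 1 < r then (if (j : ℕ) = (i : ℕ) + 1 then 1 else 0)
    else if (j : ℕ) = 0 then (PowerSeries.X - PowerSeries.C θ) * PowerSeries.C (A r)⁻¹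
    else -(PowerSeries.C (A (j : ℕ)) * PowerSeries.C (A r)⁻¹)

/-- `h = φ_{t^{N−1}}(ξ) + φ_{t^{N−2}}(ξ) t + ⋯ + ξ t^{N−1}` viewed in `𝕂[[t]]`. -/
def hPS (q r N : ℕ) (θ : 𝕂) (A : ℕ → 𝕂) (ξ : 𝕂) : PowerSeries 𝕂 :=
  ∑ mm ∈ Finset.range N, PowerSeries.C ((phiT 𝕂 q r θ A)^[N - 1 - mm] ξ) * PowerSeries.X ^ mm

/-- The matrix `B = (h_j^{(i−1)})`. -/
def BPS (q r N : ℕ) (θ : 𝕂) (A : ℕ → 𝕂) (ξ : Fin r → 𝕂) :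
    Matrix (Fin r) (Fin r) (PowerSeries 𝕂) :=
  Matrix.of fun i j => twist 𝕂 q (i : ℕ) (hPS 𝕂 q r N θ A (ξ j))

/-- Partial products `F F^{(1)} ⋯ F^{(n)}` (successive factors multiplied on the right). -/
def prodTwists {r : ℕ} (q : ℕ) (F : Matrix (Fin r) (Fin r) (PowerSeries 𝕂)) (n : ℕ) :
    Matrix (Fin r) (Fin r) (PowerSeries 𝕂) :=
  ((List.range (n + 1)).map fun k => twistM 𝕂 q k F).prod

/-- Convergence of a sequence of matrices with respect to the Gauss norm. -/
def MTendsto {r : ℕ} (g : ℕ → Matrix (Fin r) (Fin r) (PowerSeries 𝕂))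
    (P : Matrix (Fin r) (Fin r) (PowerSeries 𝕂)) : Prop :=
  Tendsto (fun n => mnorm 𝕂 (g n - P)) atTop (nhds 0)

/-- Shadowed partitions: `(S_1, …, S_r) ∈ P_r(n)` iff `S_i ⊆ {0, …, n−1}` and the translates
`S_i + j`, `0 ≤ j ≤ i−1`, partition `{0, …, n−1}` (here `S i` is the paper's `S_{i+1}`). -/
def IsShadow (r n : ℕ) (S : Fin r → Finset ℕ) : Prop :=
  (∀ i, S i ⊆ Finset.range n) ∧
    ∀ x ∈ Finset.range n, ∃! p : Fin r × ℕ, p.2 ≤ (p.1 : ℕ) ∧ ∃ y ∈ S p.1, x = y + p.2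

open Classical in
/-- The (finite) set `P_r(n)` of shadowed partitions. -/
def shadowFinset (r n : ℕ) : Finset (Fin r → Finset ℕ) :=
  (Fintype.piFinset fun _ : Fin r => (Finset.range n).powerset).filter (IsShadow r n)

/-- `𝓑_n(t)` as an element of `𝕂[[t]]` (expanded on the unit disk). -/
def BnPS (q r : ℕ) (θ : 𝕂) (A : ℕ → 𝕂) (n : ℕ) : PowerSeries 𝕂 :=
  ∑ S ∈ shadowFinset r n, ∏ i : Fin r, ∏ j ∈ S i,
    PowerSeries.C (A ((i : ℕ) + 1) ^ q ^ j) *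
      (PowerSeries.X - PowerSeries.C (θ ^ q ^ ((i : ℕ) + 1 + j)))⁻¹

/-- Partial sums of `ℒ_φ(ξ;t) = Σ_n 𝓑_n(t) ξ^{q^n}`. -/
def LPartial (q r : ℕ) (θ : 𝕂) (A : ℕ → 𝕂) (ξ : 𝕂) (n : ℕ) : PowerSeries 𝕂 :=
  ∑ k ∈ Finset.range (n + 1), BnPS 𝕂 q r θ A k * PowerSeries.C (ξ ^ q ^ k)

/-- The exponential function `exp_φ(z) = Σ α_n z^{q^n}`. -/
def expF (q : ℕ) (α : ℕ → 𝕂) (z : 𝕂) : 𝕂 := ∑' n : ℕ, α n * z ^ q ^ n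

/-- Anderson generating function `f_φ(u;t) = Σ_m exp_φ(u/θ^{m+1}) t^m`. -/
def AGF (q : ℕ) (α : ℕ → 𝕂) (θ u : 𝕂) : PowerSeries 𝕂 :=
  PowerSeries.mk fun mm => expF 𝕂 q α (u / θ ^ (mm + 1))

/-- The subring `A = 𝔽_q[θ]` of `𝕂`. -/
def Asubring (q : ℕ) (θ : 𝕂) : Subring 𝕂 :=
  Subring.closure ({θ} ∪ {c : 𝕂 | c ^ q = c})

/-- `π_1, …, π_r` is an `A`-basis of the period lattice `Λ_φ = ker exp_φ`. -/
def IsPeriodBasis (q r : ℕ) (α : ℕ → 𝕂) (θ : 𝕂) (π : Fin r → 𝕂) : Prop :=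
  (∀ j, expF 𝕂 q α (π j) = 0) ∧
    ∀ z, expF 𝕂 q α z = 0 →
      ∃! a : Fin r → 𝕂, (∀ j, a j ∈ Asubring 𝕂 q θ) ∧ z = ∑ j, a j * π j

/-- Frobenius twist on `𝕂(t)`, induced by a Frobenius endomorphism of `𝕂`. -/
def twistRF (frobq : 𝕂 →+* 𝕂) : RatFunc 𝕂 →+* RatFunc 𝕂 :=
  RatFunc.mapRingHom (Polynomial.mapRingHom frobq) (by
    intro pp hpp
    simp only [Submonoid.mem_comap, Polynomial.coe_mapRingHom]
    rw [mem_nonZeroDivisors_iff_ne_zero] at hpp ⊢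
    exact (Polynomial.map_ne_zero_iff frobq.injective).mpr hpp)

/-- Entrywise `n`-fold Frobenius twist of a matrix over `𝕂(t)`. -/
def twistMRF {r : ℕ} (frobq : 𝕂 →+* 𝕂) (n : ℕ)
    (M : Matrix (Fin r) (Fin r) (RatFunc 𝕂)) : Matrix (Fin r) (Fin r) (RatFunc 𝕂) :=
  Matrix.of fun i j => (fun g => twistRF 𝕂 frobq g)^[n] (M i j)

/-- The matrix `Θ`, with entries viewed in `𝕂(t)`. -/
def ThetaRF (r : ℕ) (θ : 𝕂) (A : ℕ → 𝕂) : Matrix (Fin r) (Fin r) (RatFunc 𝕂) :=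
  Matrix.of fun i j =>
    if (i : ℕ) + 1 < r then (if (j : ℕ) = (i : ℕ) + 1 then 1 else 0)
    else if (j : ℕ) = 0 then (RatFunc.X - RatFunc.C θ) / RatFunc.C (A r)
    else -(RatFunc.C (A (j : ℕ)) / RatFunc.C (A r))

/-- `h` as an element of `𝕂(t)`. -/
def hRF (q r N : ℕ) (θ : 𝕂) (A : ℕ → 𝕂) (ξ : 𝕂) : RatFunc 𝕂 :=
  ∑ mm ∈ Finset.range N, RatFunc.C ((phiT 𝕂 q r θ A)^[N - 1 - mm] ξ) * RatFunc.X ^ mm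

/-- The matrix `B = (h_j^{(i−1)})` over `𝕂(t)`. -/
def BRF (q r N : ℕ) (frobq : 𝕂 →+* 𝕂) (θ : 𝕂) (A : ℕ → 𝕂) (ξ : Fin r → 𝕂) :
    Matrix (Fin r) (Fin r) (RatFunc 𝕂) :=
  Matrix.of fun i j => (fun g => twistRF 𝕂 frobq g)^[(i : ℕ)] (hRF 𝕂 q r N θ A (ξ j))

/-- The matrix `W` with first row `(ξ_1, …, ξ_r)` and all other entries `0`. -/
def WRF (r : ℕ) (ξ : Fin r → 𝕂) : Matrix (Fin r) (Fin r) (RatFunc 𝕂) :=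
  Matrix.of fun i j => if (i : ℕ) = 0 then RatFunc.C (ξ j) else 0

/-- `R_0 = I/(t−θ)` and `R_m = Θ^{−1}(Θ^{−1})^{(1)} ⋯ (Θ^{−1})^{(m−1)}/(t−θ^{q^m})`. -/
def RmRF (r : ℕ) (frobq : 𝕂 →+* 𝕂) (q : ℕ) (θ : 𝕂) (A : ℕ → 𝕂) (mm : ℕ) :
    Matrix (Fin r) (Fin r) (RatFunc 𝕂) :=
  (RatFunc.X - RatFunc.C (θ ^ q ^ mm))⁻¹ •
    ((List.range mm).map fun k => twistMRF 𝕂 frobq k (ThetaRF 𝕂 r θ A)⁻¹).prod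

/-- `𝓑_n(t)` as an element of `𝕂(t)`. -/
def BnRF (q r : ℕ) (θ : 𝕂) (A : ℕ → 𝕂) (n : ℕ) : RatFunc 𝕂 :=
  ∑ S ∈ shadowFinset r n, ∏ i : Fin r, ∏ j ∈ S i,
    RatFunc.C (A ((i : ℕ) + 1) ^ q ^ j) / (RatFunc.X - RatFunc.C (θ ^ q ^ ((i : ℕ) + 1 + j)))

/-- `𝓑_n(t)` for integer `n`, with `𝓑_n = 0` for `n < 0`. -/
def BnRFZ (q r : ℕ) (θ : 𝕂) (A : ℕ → 𝕂) (n : ℤ) : RatFunc 𝕂 :=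
  if n < 0 then 0 else BnRF 𝕂 q r θ A n.toNat

/-- `F = B^{−1} Θ^{−1} B^{(1)}` over `𝕂(t)`. -/
def FRF (q r N : ℕ) (frobq : 𝕂 →+* 𝕂) (θ : 𝕂) (A : ℕ → 𝕂) (ξ : Fin r → 𝕂) :
    Matrix (Fin r) (Fin r) (RatFunc 𝕂) :=
  (BRF 𝕂 q r N frobq θ A ξ)⁻¹ * (ThetaRF 𝕂 r θ A)⁻¹ *
    twistMRF 𝕂 frobq 1 (BRF 𝕂 q r N frobq θ A ξ)

/-- `Π_n = B F F^{(1)} ⋯ F^{(n)}` over `𝕂(t)`. -/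
def PiNRF (q r N : ℕ) (frobq : 𝕂 →+* 𝕂) (θ : 𝕂) (A : ℕ → 𝕂) (ξ : Fin r → 𝕂) (n : ℕ) :
    Matrix (Fin r) (Fin r) (RatFunc 𝕂) :=
  BRF 𝕂 q r N frobq θ A ξ *
    ((List.range (n + 1)).map fun k => twistMRF 𝕂 frobq k (FRF 𝕂 q r N frobq θ A ξ)).prod

/-- Weighted coefficient bound: `‖f_n‖ s^n ≤ c` for all `n`. -/
def Bd {K : Type} [NontriviallyNormedField K] (s : ℝ) (f : PowerSeries K) (c : ℝ) : Prop :=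
  ∀ n, ‖PowerSeries.coeff n f‖ * s ^ n ≤ c

lemma Bd.nonneg {K : Type} [NontriviallyNormedField K] {s : ℝ} {f : PowerSeries K} {c : ℝ}
    (h : Bd s f c) : 0 ≤ c := by
  have := h 0
  simp only [pow_zero, mul_one] at this
  exact (norm_nonneg _).trans this

lemma Bd.mono {K : Type} [NontriviallyNormedField K] {s : ℝ} {f : PowerSeries K} {c d : ℝ}
    (h : Bd s f c) (hcd : c ≤ d) : Bd s f d := fun n => (h n).trans hcd

lemma Bd.one_of {K : Type} [NontriviallyNormedField K] {s : ℝ} (hs : 1 ≤ s)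
    {f : PowerSeries K} {c : ℝ} (h : Bd s f c) : Bd 1 f c := fun n => by
  refine le_trans ?_ (h n)
  rw [one_pow]
  exact mul_le_mul_of_nonneg_left (one_le_pow₀ hs) (norm_nonneg _)

lemma Bd.neg {K : Type} [NontriviallyNormedField K] {s : ℝ}
    {f : PowerSeries K} {c : ℝ} (h : Bd s f c) : Bd s (-f) c := fun n => by
  simpa using h n

lemma Bd.mul {K : Type} [NontriviallyNormedField K] [IsUltrametricDist K] {s : ℝ} (hs : 0 < s)
    {f g : PowerSeries K} {c d : ℝ} (hf : Bd s f c) (hg : Bd s g d) : Bd s (f * g) (c * d) := by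
  intro n
  rw [PowerSeries.coeff_mul]
  rw [← le_div_iff₀ (by positivity)]
  refine IsUltrametricDist.norm_sum_le_of_forall_le_of_nonneg
    (div_nonneg (mul_nonneg hf.nonneg hg.nonneg) (by positivity)) ?_
  rintro ⟨i, j⟩ hij
  rw [Finset.HasAntidiagonal.mem_antidiagonal] at hij
  simp only at hij
  rw [le_div_iff₀ (by positivity), ← hij, norm_mul, pow_add]
  calc _ = (‖PowerSeries.coeff i f‖ * s ^ i) * (‖PowerSeries.coeff j g‖ * s ^ j) := by ring
    _ ≤ c * d := mul_le_mul (hf i) (hg j) (by positivity) hf.nonneg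

lemma Bd.sum {K : Type} [NontriviallyNormedField K] [IsUltrametricDist K] {s : ℝ} (hs : 0 < s)
    {ι : Type} (S : Finset ι) (f : ι → PowerSeries K) {c : ℝ} (hc : 0 ≤ c)
    (hf : ∀ i ∈ S, Bd s (f i) c) : Bd s (∑ i ∈ S, f i) c := by
  intro n
  rw [map_sum, ← le_div_iff₀ (by positivity)]
  refine IsUltrametricDist.norm_sum_le_of_forall_le_of_nonneg (by positivity) ?_
  intro i hi
  rw [le_div_iff₀ (by positivity)]
  exact hf i hi n

lemma Bd.C {K : Type} [NontriviallyNormedField K] {s : ℝ} (a : K) :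
    Bd s (PowerSeries.C a) ‖a‖ := by
  intro n
  rw [PowerSeries.coeff_C]
  split_ifs with h
  · simp [h]
  · simp

lemma Bd.Xpow {K : Type} [NontriviallyNormedField K] (N : ℕ) :
    Bd 1 (PowerSeries.X ^ N : PowerSeries K) 1 := by
  intro n
  rw [PowerSeries.coeff_X_pow]
  split_ifs with h
  · simp
  · simp

lemma Bd.prod {K : Type} [NontriviallyNormedField K] [IsUltrametricDist K] {s : ℝ} (hs : 0 < s)
    {ι : Type} (S : Finset ι) (f : ι → PowerSeries K) (c : ι → ℝ)
    (hf : ∀ i ∈ S, Bd s (f i) (c i)) : Bd s (∏ i ∈ S, f i) (∏ i ∈ S, c i) := by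
  classical
  induction S using Finset.induction_on with
  | empty =>
    simp only [Finset.prod_empty]
    have := Bd.C (s := s) (1 : K)
    simpa using this
  | insert a S ha ih =>
    rw [Finset.prod_insert ha, Finset.prod_insert ha]
    exact Bd.mul hs (hf a (Finset.mem_insert_self _ _))
      (ih fun i hi => hf i (Finset.mem_insert_of_mem hi))

lemma Bd.inv {K : Type} [NontriviallyNormedField K] [IsUltrametricDist K] {s : ℝ} (hs : 0 < s)
    {f : PowerSeries K} {c : ℝ} (hc : 0 < c) (hf : Bd s f c)
    (h0 : ‖PowerSeries.constantCoeff f‖ = c) : Bd s f⁻¹ c⁻¹ := by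
  intro n
  induction n using Nat.strong_induction_on with
  | _ n ih =>
    rw [PowerSeries.coeff_inv]
    split_ifs with h
    · simp [h, h0]
    · rw [norm_mul, norm_neg, norm_inv, h0, mul_assoc]
      conv_rhs => rw [← mul_one c⁻¹]
      refine mul_le_mul_of_nonneg_left ?_ (by positivity)
      rw [← le_div_iff₀ (by positivity)]
      refine IsUltrametricDist.norm_sum_le_of_forall_le_of_nonneg (by positivity) ?_
      rintro ⟨i, j⟩ hij
      rw [Finset.HasAntidiagonal.mem_antidiagonal] at hij
      simp only at hij
      split_ifs with hj
      · rw [le_div_iff₀ (by positivity), ← hij, norm_mul, pow_add]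
        calc _ = (‖PowerSeries.coeff i f‖ * s ^ i) * (‖PowerSeries.coeff j f⁻¹‖ * s ^ j) := by ring
          _ ≤ c * c⁻¹ := mul_le_mul (hf i) (ih j hj) (by positivity) hc.le
          _ = 1 := mul_inv_cancel₀ hc.ne'
      · simp; positivity

lemma Bd.isTate {K : Type} [NontriviallyNormedField K] {s : ℝ} (hs : 1 < s)
    {f : PowerSeries K} {c : ℝ} (hf : Bd s f c) : IsTate K f := by
  have h0 : (0 : ℝ) < s := by linarith
  have h1 : Tendsto (fun i : ℕ => c * (s⁻¹) ^ i) atTop (nhds (c * 0)) :=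
    (tendsto_pow_atTop_nhds_zero_of_lt_one (by positivity) (inv_lt_one_of_one_lt₀ hs)).const_mul c
  rw [mul_zero] at h1
  refine squeeze_zero (fun _ => norm_nonneg _) (fun i => ?_) h1
  rw [inv_pow, ← div_eq_mul_inv, le_div_iff₀ (by positivity)]
  exact hf i

lemma Bd.gnorm_le {K : Type} [NontriviallyNormedField K]
    {f : PowerSeries K} {c : ℝ} (hf : Bd 1 f c) : gnorm K f ≤ c :=
  ciSup_le fun i => by simpa using hf i

lemma rearr {r q : ℕ} (hq : 1 ≤ q) (a : Fin r → ℝ) (ha : ∀ i, 0 < a i) (hmono : Monotone a)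
    (σ : Equiv.Perm (Fin r)) :
    ∏ i, a i ^ q ^ (σ i : ℕ) ≤ ∏ i, a i ^ q ^ (i : ℕ) := by
  have h1 : ∀ τ : Equiv.Perm (Fin r), 0 < ∏ i, a i ^ q ^ (τ i : ℕ) := fun τ =>
    Finset.prod_pos fun i _ => pow_pos (ha i) _
  rw [← Real.log_le_log_iff (h1 σ) (by simpa using h1 1)]
  rw [Real.log_prod (fun i _ => (pow_pos (ha i) _).ne'),
    Real.log_prod (fun i _ => (pow_pos (ha i) _).ne')]
  have h2 : Monovary (fun i => Real.log (a i)) (fun i : Fin r => ((q ^ (i : ℕ) : ℕ) : ℝ)) := by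
    apply Monotone.monovary
    · intro i j hij
      exact Real.log_le_log (ha i) (hmono hij)
    · intro i j hij
      exact Nat.cast_le.mpr (Nat.pow_le_pow_right hq hij)
  have := h2.sum_mul_comp_perm_le_sum_mul (σ := σ)
  simpa [Real.log_pow, mul_comm] using this

lemma det_bd {K : Type} [NontriviallyNormedField K] [IsUltrametricDist K] {s : ℝ} (hs : 0 < s)
    {r : ℕ} (M : Matrix (Fin r) (Fin r) (PowerSeries K)) (c : ℝ) (hc : 0 ≤ c)
    (h : ∀ σ : Equiv.Perm (Fin r), Bd s (∏ i, M (σ i) i) c) : Bd s M.det c := by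
  rw [Matrix.det_apply]
  refine Bd.sum hs _ _ hc fun σ _ => ?_
  rcases Int.units_eq_one_or (Equiv.Perm.sign σ) with h1 | h1
  · simpa [h1] using h σ
  · rw [h1]
    simpa using (h σ).neg

lemma fixed_card {K : Type} [NontriviallyNormedField K] [IsAlgClosed K] (p e q : ℕ)
    (hp : p.Prime) [CharP K p] (he : 0 < e) (hqpe : q = p ^ e) :
    ∃ S : Finset K, S.card = q ∧ ∀ c ∈ S, c ^ q = c := by
  classical
  have hq : 1 < q := by rw [hqpe]; exact Nat.one_lt_pow he.ne' hp.one_lt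
  have hsep : (Polynomial.X ^ q - Polynomial.X : Polynomial K).Separable :=
    galois_poly_separable p q (by rw [hqpe]; exact dvd_pow_self p he.ne')
  refine ⟨(Polynomial.X ^ q - Polynomial.X : Polynomial K).roots.toFinset, ?_, ?_⟩
  · rw [Multiset.toFinset_card_of_nodup (Polynomial.nodup_roots hsep),
      IsAlgClosed.card_roots_eq_natDegree]
    exact FiniteField.X_pow_card_sub_X_natDegree_eq K hq
  · intro c hc
    rw [Multiset.mem_toFinset, Polynomial.mem_roots hsep.ne_zero] at hc
    simpa [Polynomial.IsRoot, sub_eq_zero] using hc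

lemma moore_ne_zero {K : Type} [NontriviallyNormedField K] [IsAlgClosed K] (p e q : ℕ)
    (hp : p.Prime) [CharP K p] (he : 0 < e) (hqpe : q = p ^ e) (r : ℕ) (hr : 0 < r)
    (x : Fin r → K) (hind : ∀ c : Fin r → K, (∀ j, c j ^ q = c j) → ∑ j, c j * x j = 0 → c = 0) :
    (Matrix.of fun i j : Fin r => x j ^ q ^ (i : ℕ)).det ≠ 0 := by
  classical
  have : Fact p.Prime := ⟨hp⟩
  have hq : 1 < q := by rw [hqpe]; exact Nat.one_lt_pow he.ne' hp.one_lt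
  intro hdet
  obtain ⟨v, hv0, hv⟩ := Matrix.exists_vecMul_eq_zero_iff.mpr hdet
  obtain ⟨S, hScard, hS⟩ := fixed_card (K := K) p e q hp he hqpe
  apply hv0
  have hfrob : ∀ (i : ℕ) (y : K), y ^ q ^ i = iterateFrobenius K p (e * i) y := by
    intro i y
    rw [iterateFrobenius_def, hqpe, pow_mul]
  have hcfix : ∀ c : K, c ^ q = c → ∀ i : ℕ, c ^ q ^ i = c := by
    intro c hc i
    induction i with
    | zero => simp
    | succ i ih => rw [pow_succ, pow_mul, ih, hc]
  set Q : Polynomial K := ∑ i : Fin r, Polynomial.C (v i) * Polynomial.X ^ q ^ (i : ℕ) with hQ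
  have hQ0 : Q = 0 := by
    refine Polynomial.eq_zero_of_natDegree_lt_card_of_eval_eq_zero' Q
      ((Fintype.piFinset fun _ : Fin r => S).image fun c => ∑ j, c j * x j) ?_ ?_
    · intro y hy
      rw [Finset.mem_image] at hy
      obtain ⟨c, hc, rfl⟩ := hy
      rw [Fintype.mem_piFinset] at hc
      rw [hQ, Polynomial.eval_finsetSum]
      simp only [Polynomial.eval_mul, Polynomial.eval_C, Polynomial.eval_pow, Polynomial.eval_X]
      have h1 : ∀ i : Fin r, (∑ j, c j * x j) ^ q ^ (i : ℕ) = ∑ j, c j * x j ^ q ^ (i : ℕ) := by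
        intro i
        rw [hfrob, map_sum]
        refine Finset.sum_congr rfl fun j _ => ?_
        rw [map_mul, ← hfrob, ← hfrob, hcfix _ (hS _ (hc j))]
      simp only [h1, Finset.mul_sum]
      rw [Finset.sum_comm]
      refine Finset.sum_eq_zero fun j _ => ?_
      have h2 := congrFun hv j
      simp only [Matrix.vecMul, dotProduct, Matrix.of_apply, Pi.zero_apply] at h2
      calc _ = c j * ∑ i : Fin r, v i * x j ^ q ^ (i : ℕ) := by
            rw [Finset.mul_sum]; exact Finset.sum_congr rfl fun i _ => by ring
        _ = 0 := by rw [h2, mul_zero]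
    · rw [Finset.card_image_of_injOn, Fintype.card_piFinset]
      · simp only [hScard, Finset.prod_const, Finset.card_univ, Fintype.card_fin]
        refine lt_of_le_of_lt (Polynomial.natDegree_sum_le_of_forall_le (n := q ^ (r - 1)) _ _ ?_) ?_
        · intro i _
          refine (Polynomial.natDegree_C_mul_X_pow_le _ _).trans ?_
          exact Nat.pow_le_pow_right (by omega) (by omega)
        · exact Nat.pow_lt_pow_right hq (by omega)
      · intro c hc c' hc' h
        simp only [Finset.mem_coe, Fintype.mem_piFinset] at hc hc'
        simp only at h
        have := hind (c - c') (fun j => ?_) ?_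
        · exact sub_eq_zero.mp this
        · have h3 := hfrob 1 (c j - c' j)
          rw [map_sub, ← hfrob, ← hfrob, pow_one, hS _ (hc j), hS _ (hc' j)] at h3
          exact h3
        · simp only [Pi.sub_apply, sub_mul, Finset.sum_sub_distrib, h, sub_self]
  funext i
  have h4 := congrArg (fun P => Polynomial.coeff P (q ^ (i : ℕ))) hQ0
  simp only [hQ, Polynomial.finsetSum_coeff, Polynomial.coeff_C_mul, Polynomial.coeff_X_pow,
    Polynomial.coeff_zero] at h4
  rw [Finset.sum_eq_single i] at h4
  · simpa using h4
  · intro j _ hj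
    rw [if_neg, mul_zero]
    intro h5
    exact hj (Fin.ext (Nat.pow_right_injective hq h5).symm)
  · simp

lemma theta_det {K : Type} [NontriviallyNormedField K] (r : ℕ) (hr : 0 < r) (θ : K) (A : ℕ → K) :
    (ThetaPS K r θ A).det =
      (-1) ^ (r - 1) * ((PowerSeries.X - PowerSeries.C θ) * PowerSeries.C (A r)⁻¹) := by
  obtain ⟨k, rfl⟩ : ∃ k, r = k + 1 := ⟨r - 1, by omega⟩
  rw [Matrix.det_succ_column_zero, Finset.sum_eq_single (Fin.last k)]
  · have : (ThetaPS K (k + 1) θ A).submatrix (Fin.last k).succAbove Fin.succ = 1 := by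
      ext1 i j
      simp only [ThetaPS, Matrix.submatrix_apply, Matrix.of_apply, Fin.succAbove_last,
        Fin.val_castSucc, Fin.val_succ, Matrix.one_apply]
      rw [if_pos (by omega)]
      congr 1
      simp only [Fin.ext_iff, eq_iff_iff]
      omega
    rw [this]
    simp [ThetaPS]
  · intro i _ hi
    have : (i : ℕ) < k := by
      have := i.2
      have h2 : (i : ℕ) ≠ k := fun h => hi (Fin.ext h)
      omega
    simp [ThetaPS, this]
  · simp

lemma coeff_hPS {K : Type} [NontriviallyNormedField K] (q r N : ℕ) (θ : K) (A : ℕ → K) (ξ : K)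
    (n : ℕ) : PowerSeries.coeff n (hPS K q r N θ A ξ) =
      if n < N then (phiT K q r θ A)^[N - 1 - n] ξ else 0 := by
  simp only [hPS, map_sum, PowerSeries.coeff_C_mul, PowerSeries.coeff_X_pow, mul_ite, mul_one,
    mul_zero, Finset.sum_ite_eq, Finset.mem_range]

lemma phiT_zero {K : Type} [NontriviallyNormedField K] (q r : ℕ) (hq : 0 < q) (θ : K)
    (A : ℕ → K) : phiT K q r θ A 0 = 0 := by
  simp only [phiT, mul_zero, zero_add]
  refine Finset.sum_eq_zero fun i _ => ?_
  rw [zero_pow (pow_pos hq i).ne', mul_zero]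

lemma hPS_eq {K : Type} [NontriviallyNormedField K] (q r N : ℕ) (hq : 0 < q) (hN : 1 ≤ N) (θ : K)
    (A : ℕ → K) (ξ : K) (hξ : (phiT K q r θ A)^[N] ξ = 0) :
    PowerSeries.C θ * hPS K q r N θ A ξ
      + ∑ i ∈ Finset.Icc 1 r, PowerSeries.C (A i) * twist K q i (hPS K q r N θ A ξ)
      = PowerSeries.X * hPS K q r N θ A ξ - PowerSeries.C ξ * PowerSeries.X ^ N := by
  ext n
  have h1 : PowerSeries.coeff n (PowerSeries.C θ * hPS K q r N θ A ξ
      + ∑ i ∈ Finset.Icc 1 r, PowerSeries.C (A i) * twist K q i (hPS K q r N θ A ξ))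
      = phiT K q r θ A (PowerSeries.coeff n (hPS K q r N θ A ξ)) := by
    simp only [map_add, map_sum, PowerSeries.coeff_C_mul, twist, PowerSeries.coeff_mk, phiT]
  rw [h1, coeff_hPS, map_sub, PowerSeries.coeff_C_mul, PowerSeries.coeff_X_pow]
  rcases n with _ | n
  · rw [if_pos (by omega), ← Function.iterate_succ_apply' (phiT K q r θ A), if_neg (by omega)]
    have : (N - 1 - 0).succ = N := by omega
    rw [this, hξ]
    simp
  · rw [PowerSeries.coeff_succ_X_mul, coeff_hPS]
    rcases lt_trichotomy (n + 1) N with h | h | h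
    · rw [if_pos h, if_pos (by omega), if_neg (by omega),
        ← Function.iterate_succ_apply' (phiT K q r θ A)]
      have : (N - 1 - (n + 1)).succ = N - 1 - n := by omega
      rw [this]; simp
    · rw [if_neg (by omega), if_pos (by omega), if_pos h, phiT_zero q r hq]
      have : N - 1 - n = 0 := by omega
      rw [this]; simp
    · rw [if_neg (by omega), if_neg (by omega), if_neg (by omega), phiT_zero q r hq]
      simp

lemma theta_last {K : Type} [NontriviallyNormedField K] (r : ℕ) (hr : 0 < r) (θ : K) (A : ℕ → K)
    (hAr : A r ≠ 0)
    (w : ℕ → PowerSeries K) (i : Fin r) (hi : ¬ (i : ℕ) + 1 < r) (y : PowerSeries K)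
    (hw : PowerSeries.C θ * w 0 + ∑ j ∈ Finset.Icc 1 r, PowerSeries.C (A j) * w j
      = PowerSeries.X * w 0 - y) :
    ∑ j : Fin r, ThetaPS K r θ A i j * w (j : ℕ) = w r + y * PowerSeries.C (A r)⁻¹ := by
  obtain ⟨k, rfl⟩ : ∃ k, r = k + 1 := ⟨r - 1, by omega⟩
  have hC : PowerSeries.C (A (k + 1)) * PowerSeries.C (A (k + 1))⁻¹ = (1 : PowerSeries K) := by
    rw [← map_mul, mul_inv_cancel₀ hAr, map_one]
  have h1 : ∑ j ∈ Finset.Icc 1 (k + 1), PowerSeries.C (A j) * w j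
      = ∑ j : Fin k, PowerSeries.C (A ((j : ℕ) + 1)) * w ((j : ℕ) + 1)
        + PowerSeries.C (A (k + 1)) * w (k + 1) := by
    rw [Finset.sum_Icc_succ_top (by omega)]
    congr 1
    rw [Fin.sum_univ_eq_sum_range (fun j => PowerSeries.C (A (j + 1)) * w (j + 1)),
      Finset.range_eq_Ico, Finset.sum_Ico_add' (fun j => PowerSeries.C (A j) * w j) 0 k 1]
    rfl
  rw [h1] at hw
  rw [Fin.sum_univ_succ]
  have h2 : ∑ j : Fin k, ThetaPS K (k + 1) θ A i j.succ * w (j.succ : ℕ)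
      = - (∑ j : Fin k, PowerSeries.C (A ((j : ℕ) + 1)) * w ((j : ℕ) + 1))
          * PowerSeries.C (A (k + 1))⁻¹ := by
    rw [neg_mul, Finset.sum_mul, ← Finset.sum_neg_distrib]
    refine Finset.sum_congr rfl fun j _ => ?_
    simp only [ThetaPS, Matrix.of_apply, if_neg hi, Fin.val_succ]
    rw [if_neg (by omega)]
    ring
  rw [h2]
  have h3 : ThetaPS K (k + 1) θ A i 0
      = (PowerSeries.X - PowerSeries.C θ) * PowerSeries.C (A (k + 1))⁻¹ := by
    simp only [ThetaPS, Matrix.of_apply, if_neg hi]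
    simp
  rw [h3, Fin.val_zero]
  linear_combination (-PowerSeries.C (A (k + 1))⁻¹) * hw + w (k + 1) * hC

lemma newton_aux {K : Type} [NontriviallyNormedField K] (q r : ℕ) (hq : 1 < q) (θ : K) (A : ℕ → K)
    (ND : NewtonData K q r θ A) (L : ℕ → ℝ)
    (hL : ∀ k, 1 ≤ k → k ≤ ND.s → ∀ j, ND.d (k - 1) ≤ j → j < ND.d k → L j = ND.lam k) (k : ℕ)
    (hk : k ≤ ND.s) :
    (∀ i j, i ≤ j → j < ND.d k → L i ≤ L j) ∧ (∀ i < ND.d k, L i ≤ ND.lam k) ∧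
      ∑ j ∈ Finset.range (ND.d k), L j * ((q : ℝ) ^ (j + 1) - (q : ℝ) ^ j) =
        degK K q θ - degK K q (Acoef K θ A (ND.d k)) := by
  induction k with
  | zero => simp [ND.d_zero, Acoef]
  | succ k ih =>
    obtain ⟨h1, h2, h3⟩ := ih (by omega)
    have hd := ND.d_mono k (by omega)
    have hblk : ∀ j, ND.d k ≤ j → j < ND.d (k + 1) → L j = ND.lam (k + 1) := fun j h h' =>
      hL (k + 1) (by omega) hk j (by simpa using h) h'
    have h4 : ∀ i < ND.d k, L i ≤ ND.lam (k + 1) := by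
      intro i hi
      have hk1 : 1 ≤ k := by
        rcases k with _ | k
        · rw [ND.d_zero] at hi; omega
        · omega
      exact (h2 i hi).trans (ND.lam_mono k hk1 hk).le
    refine ⟨?_, ?_, ?_⟩
    · intro i j hij hj
      rcases lt_or_ge j (ND.d k) with h | h
      · exact h1 i j hij h
      · rw [hblk j h hj]
        rcases lt_or_ge i (ND.d k) with h' | h'
        · exact h4 i h'
        · rw [hblk i h' (by omega)]
    · intro i hi
      rcases lt_or_ge i (ND.d k) with h' | h'
      · exact h4 i h'
      · rw [hblk i h' hi]
    · rw [← Finset.sum_range_add_sum_Ico _ hd.le, h3]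
      have h5 : ∑ j ∈ Finset.Ico (ND.d k) (ND.d (k + 1)), L j * ((q : ℝ) ^ (j + 1) - (q : ℝ) ^ j)
          = ND.lam (k + 1) * ((q : ℝ) ^ ND.d (k + 1) - (q : ℝ) ^ ND.d k) := by
        rw [← Finset.sum_Ico_sub (fun j => (q : ℝ) ^ j) hd.le, Finset.mul_sum]
        refine Finset.sum_congr rfl fun j hj => ?_
        rw [Finset.mem_Ico] at hj
        rw [hblk j hj.1 hj.2]
      have hpos : (0 : ℝ) < (q : ℝ) ^ ND.d (k + 1) - (q : ℝ) ^ ND.d k := by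
        rw [sub_pos]
        exact pow_lt_pow_right₀ (by exact_mod_cast hq) hd
      rw [h5, ND.slope_eq (k + 1) (by omega) hk, Nat.add_sub_cancel, div_mul_cancel₀ _ hpos.ne']
      ring

lemma newton_final {K : Type} [NontriviallyNormedField K] (q r : ℕ) (hq : 1 < q) (hr : 0 < r)
    (θ : K) (hθ : ‖θ‖ = (q : ℝ)) (A : ℕ → K) (hAr : A r ≠ 0)
    (ND : NewtonData K q r θ A) (m : ℕ) (hm : IsMuIndex K q r A m)
    (x : Fin r → K) (hxs : IsStrict K q r θ A ND x) (hx0 : ∀ j, x j ≠ 0) :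
    Monotone (fun j => ‖x j‖) ∧
      (∏ i, ‖x i‖ ^ q ^ (i : ℕ)) ^ (q - 1) = q / ‖A r‖ ∧
      Rphi K q A m ≤ q * ‖x ⟨0, hr⟩‖ := by
  have hq1 : (1 : ℝ) < q := by exact_mod_cast hq
  have hq0 : (0 : ℝ) < q := by linarith
  have hpos : ∀ j, 0 < ‖x j‖ := fun j => norm_pos_iff.mpr (hx0 j)
  have hdle : ∀ k, k ≤ ND.s → ND.d k ≤ r := by
    have : ∀ n k, k + n = ND.s → ND.d k ≤ r := by
      intro n
      induction n with
      | zero => intro k hk; rw [add_zero] at hk; rw [hk, ND.d_last]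
      | succ n ih =>
        intro k hk
        exact (ND.d_mono k (by omega)).le.trans (ih (k + 1) (by omega))
    intro k hk
    exact this (ND.s - k) k (by omega)
  set L : ℕ → ℝ := fun j => if h : j < r then degK K q (x ⟨j, h⟩) else 0 with hLdef
  have hLx : ∀ j : Fin r, L j = degK K q (x j) := fun j => by simp [hLdef]
  have hL : ∀ k, 1 ≤ k → k ≤ ND.s → ∀ j, ND.d (k - 1) ≤ j → j < ND.d k → L j = ND.lam k := by
    intro k h1 h2 j h3 h4
    have hj : j < r := h4.trans_le (hdle k h2)
    have := hxs k h1 h2 ⟨j, hj⟩ h3 h4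
    simpa [hLdef, hj] using this
  obtain ⟨g1, -, g3⟩ := newton_aux q r hq θ A ND L hL ND.s le_rfl
  rw [ND.d_last] at g1 g3
  have hdθ : degK K q θ = 1 := by
    rw [degK, hθ]; exact Real.logb_self_eq_one hq1
  have hnx : ∀ j, ‖x j‖ = (q : ℝ) ^ degK K q (x j) := fun j =>
    (Real.rpow_logb hq0 hq1.ne' (hpos j)).symm
  refine ⟨?_, ?_, ?_⟩
  · intro i j hij
    have := g1 i j hij j.2
    rw [hLx, hLx] at this
    exact (Real.logb_le_logb hq1 (hpos i) (hpos j)).mp this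
  · have hA : 0 < ‖A r‖ := norm_pos_iff.mpr hAr
    have hP : 0 < ∏ i, ‖x i‖ ^ q ^ (i : ℕ) := Finset.prod_pos fun i _ => pow_pos (hpos i) _
    apply Real.logb_injOn_pos hq1 (Set.mem_Ioi.mpr (pow_pos hP _)) (Set.mem_Ioi.mpr (div_pos hq0 hA))
    rw [Real.logb_pow, Real.logb_prod (hf := fun i _ => (pow_pos (hpos i) _).ne'),
      Real.logb_div hq0.ne' hA.ne', Real.logb_self_eq_one hq1]
    rw [hdθ, Acoef, if_neg hr.ne'] at g3
    unfold degK at g3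
    rw [← g3, ← Fin.sum_univ_eq_sum_range (fun j => L j * ((q : ℝ) ^ (j + 1) - (q : ℝ) ^ j)),
      Finset.mul_sum]
    refine Finset.sum_congr rfl fun i _ => ?_
    rw [hLx, degK, Real.logb_pow, Nat.cast_sub hq.le]
    push_cast
    ring
  · have hs := ND.s_pos
    have hd1 := ND.d_mono 0 hs
    rw [ND.d_zero, zero_add] at hd1
    have h0 : degK K q (x ⟨0, hr⟩) = ND.lam 1 :=
      hxs 1 le_rfl hs ⟨0, hr⟩ (by simp [ND.d_zero]) (by simpa using hd1)
    have hsl := ND.slope_eq 1 le_rfl hs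
    rw [Nat.sub_self, ND.d_zero, Acoef, Acoef, if_pos rfl, if_neg (by omega), hdθ, pow_zero] at hsl
    have hmu := hm.2.1 (ND.d 1) ⟨hd1, hdle 1 hs, ND.vertex_ne 1 le_rfl hs⟩
    have hden : (0 : ℝ) < (q : ℝ) ^ ND.d 1 - 1 := by
      rw [sub_pos]; exact one_lt_pow₀ hq1 (by omega)
    have hmd : muPhi K q A (ND.d 1) = - ND.lam 1 - 1 := by
      rw [hsl, muPhi]
      field_simp
      ring
    rw [Rphi, hnx, h0]
    nth_rewrite 2 [← Real.rpow_one (q : ℝ)]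
    rw [← Real.rpow_add hq0]
    exact Real.rpow_le_rpow_of_exponent_le hq1.le (by linarith)

lemma theta_B {K : Type} [NontriviallyNormedField K] (q r N : ℕ) (hq : 0 < q) (hr : 0 < r)
    (hN : 1 ≤ N) (θ : K) (A : ℕ → K) (hAr : A r ≠ 0) (ξ : Fin r → K)
    (hξ : ∀ j, (phiT K q r θ A)^[N] (ξ j) = 0) :
    ThetaPS K r θ A * BPS K q r N θ A ξ = twistM K q 1 (BPS K q r N θ A ξ) +
      Matrix.of fun i k : Fin r => if (i : ℕ) + 1 < r then 0 else
        PowerSeries.C (ξ k) * PowerSeries.X ^ N * PowerSeries.C (A r)⁻¹ := by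
  have htw : ∀ (i : ℕ) (f : PowerSeries K), twist K q 1 (twist K q i f) = twist K q (i + 1) f := by
    intro i f
    ext n
    simp only [twist, PowerSeries.coeff_mk]
    rw [← pow_mul, ← pow_add]
  ext1 i k
  rw [Matrix.mul_apply, Matrix.add_apply, Matrix.of_apply]
  simp only [twistM, BPS, Matrix.of_apply, htw]
  split_ifs with hi
  · rw [add_zero, Finset.sum_eq_single ⟨(i : ℕ) + 1, hi⟩]
    · simp [ThetaPS, hi]
    · intro j _ hj
      have : (j : ℕ) ≠ (i : ℕ) + 1 := fun h => hj (Fin.ext h)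
      simp [ThetaPS, hi, this]
    · simp
  · have h0 : twist K q 0 (hPS K q r N θ A (ξ k)) = hPS K q r N θ A (ξ k) := by
      ext n; simp [twist]
    have := theta_last r hr θ A hAr (fun j => twist K q j (hPS K q r N θ A (ξ k))) i hi
      (PowerSeries.C (ξ k) * PowerSeries.X ^ N)
      (by simp only [h0]; exact hPS_eq q r N hq hN θ A (ξ k) (hξ k))
    have hi' : (i : ℕ) + 1 = r := by have := i.2; omega
    rw [hi']
    exact this

lemma theta_G {K : Type} [NontriviallyNormedField K] (r N : ℕ) (hr : 0 < r)
    (θ : K) (hθ : θ ≠ 0) (A : ℕ → K) (ξ : Fin r → K) :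
    (ThetaPS K r θ A * Matrix.of fun i k : Fin r => if (i : ℕ) = 0 then
        PowerSeries.C (ξ k) * PowerSeries.X ^ N * (PowerSeries.X - PowerSeries.C θ)⁻¹ else 0) =
      Matrix.of fun i k : Fin r => if (i : ℕ) + 1 < r then 0 else
        PowerSeries.C (ξ k) * PowerSeries.X ^ N * PowerSeries.C (A r)⁻¹ := by
  ext1 i k
  rw [Matrix.mul_apply, Finset.sum_eq_single ⟨0, hr⟩]
  · simp only [ThetaPS, Matrix.of_apply, if_true]
    split_ifs with h1 h2
    · simp at h2
    · rw [zero_mul]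
    · have h3 : (PowerSeries.X - PowerSeries.C θ) * (PowerSeries.X - PowerSeries.C θ)⁻¹
          = (1 : PowerSeries K) := PowerSeries.mul_inv_cancel _ (by simpa using hθ)
      linear_combination (PowerSeries.C (ξ k) * PowerSeries.X ^ N * PowerSeries.C (A r)⁻¹) * h3
  · intro j _ hj
    have : (j : ℕ) ≠ 0 := fun h => hj (Fin.ext h)
    simp [this]
  · simp

lemma exists_s {r : ℕ} (N : ℕ) (a : Fin r → ℝ) (c : Fin r → ℕ → ℝ)
    (h0 : ∀ j, c j 0 ≤ a j) (h1 : ∀ j n, 1 ≤ n → n < N → c j n < a j) :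
    ∃ s : ℝ, 1 < s ∧ ∀ j n, n < N → c j n * s ^ n ≤ a j := by
  have hev : ∀ᶠ s : ℝ in nhdsWithin 1 (Set.Ioi 1), ∀ j : Fin r, ∀ n : Fin N,
      c j n * s ^ (n : ℕ) ≤ a j := by
    rw [Filter.eventually_all]
    intro j
    rw [Filter.eventually_all]
    intro n
    rcases Nat.eq_zero_or_pos (n : ℕ) with h | h
    · refine Filter.Eventually.of_forall fun s => ?_
      simpa [h] using h0 j
    · have hc : ContinuousAt (fun s : ℝ => c j n * s ^ (n : ℕ)) 1 := by fun_prop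
      have hlt : (fun s : ℝ => c j n * s ^ (n : ℕ)) 1 < a j := by
        simpa using h1 j n h n.2
      have := (hc.eventually_lt_const hlt)
      exact Filter.Eventually.filter_mono nhdsWithin_le_nhds (this.mono fun s hs => hs.le)
  obtain ⟨s, hs, hs1⟩ := (hev.and self_mem_nhdsWithin).exists
  exact ⟨s, hs1, fun j n hn => hs j ⟨n, hn⟩⟩

theorem stmt0
    (𝕂 : Type) [NontriviallyNormedField 𝕂] [CompleteSpace 𝕂] [IsAlgClosed 𝕂]
    (hna : ∀ x y : 𝕂, ‖x + y‖ ≤ max ‖x‖ ‖y‖)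
    (p e q : ℕ) (hp : p.Prime) (hcharp : CharP 𝕂 p) (he : 0 < e) (hqpe : q = p ^ e)
    (θ : 𝕂) (hθ : ‖θ‖ = (q : ℝ))
    (r : ℕ) (hr : 0 < r) (A : ℕ → 𝕂) (hAr : A r ≠ 0)
    (ND : NewtonData 𝕂 q r θ A)
    (m : ℕ) (hm : IsMuIndex 𝕂 q r A m)
    (x : Fin r → 𝕂) (hxb : IsFqBasis 𝕂 q r θ A x) (hxs : IsStrict 𝕂 q r θ A ND x)
    (N : ℕ) (hN : 1 ≤ N) (ξ : Fin r → 𝕂) (hξ : GoodXi 𝕂 q r N θ A m x ξ)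
    :
    MemGLT 𝕂 (BPS 𝕂 q r N θ A ξ) ∧
      mnorm 𝕂 ((BPS 𝕂 q r N θ A ξ)⁻¹ * (ThetaPS 𝕂 r θ A)⁻¹ *
        twistM 𝕂 q 1 (BPS 𝕂 q r N θ A ξ) - 1) < 1 := by
  classical
  have : IsUltrametricDist 𝕂 :=
    IsUltrametricDist.isUltrametricDist_of_forall_norm_add_le_max_norm hna
  have : Fact p.Prime := ⟨hp⟩
  have hq : 1 < q := by rw [hqpe]; exact Nat.one_lt_pow he.ne' hp.one_lt
  have hq1 : (1 : ℝ) < q := by exact_mod_cast hq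
  have hq0 : (0 : ℝ) < q := by linarith
  have hθ0 : θ ≠ 0 := norm_pos_iff.mp (by rw [hθ]; exact hq0)
  -- linear independence
  have hind : ∀ c : Fin r → 𝕂, (∀ j, c j ^ q = c j) → ∑ j, c j * x j = 0 → c = 0 := by
    intro c hc hc0
    obtain ⟨c0, -, hu⟩ := hxb.2 0 (phiT_zero q r (by omega) θ A)
    rw [hu c ⟨hc, hc0.symm⟩, hu 0 ⟨fun j => by simp; omega, by simp⟩]
  have hx0 : ∀ j, x j ≠ 0 := by
    intro j hj
    have h1 := hind (Pi.single j 1) (fun i => by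
      by_cases h : i = j
      · subst h; simp
      · simp [h]; omega) (by simp [Pi.single_apply, hj])
    have h2 := congrFun h1 j
    simp at h2
  have hXdet := moore_ne_zero p e q hp he hqpe r hr x hind
  obtain ⟨hmono, hPq, hR⟩ := newton_final q r hq hr θ hθ A hAr ND m hm x hxs hx0
  set P : ℝ := ∏ i, ‖x i‖ ^ q ^ (i : ℕ) with hP
  have hpos : ∀ j, 0 < ‖x j‖ := fun j => norm_pos_iff.mpr (hx0 j)
  have hPpos : 0 < P := Finset.prod_pos fun i _ => pow_pos (hpos i) _
  set X : Matrix (Fin r) (Fin r) 𝕂 := Matrix.of fun i j : Fin r => x j ^ q ^ (i : ℕ) with hX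
  set B := BPS 𝕂 q r N θ A ξ with hB
  set Θ := ThetaPS 𝕂 r θ A with hΘ
  have hΘB := theta_B q r N (by omega) hr hN θ A hAr ξ fun j => (hξ j).1
  have hΘG := theta_G r N hr θ hθ0 A ξ
  rw [← hΘ] at hΘB hΘG
  rw [← hB] at hΘB
  have hBX : B.map (PowerSeries.constantCoeff (R := 𝕂)) = X := by
    ext i j
    rw [Matrix.map_apply, hB, BPS, Matrix.of_apply, ← PowerSeries.coeff_zero_eq_constantCoeff_apply,
      twist, PowerSeries.coeff_mk, coeff_hPS, if_pos (by omega), Nat.sub_zero, (hξ j).2.2.1]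
    rfl
  have hBX1 : (twistM 𝕂 q 1 B).map (PowerSeries.constantCoeff (R := 𝕂))
      = X.map (iterateFrobenius 𝕂 p e) := by
    rw [← hBX]
    ext i j
    rw [Matrix.map_apply, Matrix.map_apply, Matrix.map_apply, iterateFrobenius_def, ← hqpe,
      ← PowerSeries.coeff_zero_eq_constantCoeff_apply,
      ← PowerSeries.coeff_zero_eq_constantCoeff_apply, twistM, Matrix.of_apply, twist,
      PowerSeries.coeff_mk, pow_one]
  have hXeq : Θ.map (PowerSeries.constantCoeff (R := 𝕂)) * X = X.map (iterateFrobenius 𝕂 p e) := by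
    rw [← hBX1, ← hBX, ← Matrix.map_mul, hΘB]
    ext i j
    simp only [Matrix.map_apply, Matrix.add_apply, Matrix.of_apply, map_add]
    split_ifs
    · simp
    · simp [zero_pow (show N ≠ 0 by omega)]
  have hΘdet := theta_det r hr θ A
  rw [← hΘ] at hΘdet
  have hΘ0 : ‖(Θ.map (PowerSeries.constantCoeff (R := 𝕂))).det‖ = q / ‖A r‖ := by
    have h1 := RingHom.map_det (PowerSeries.constantCoeff (R := 𝕂)) Θ
    rw [RingHom.mapMatrix_apply] at h1
    rw [← h1, hΘdet]
    simp [hθ, div_eq_mul_inv]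
  have hdetX : ‖X.det‖ = P := by
    have h1 := congrArg (fun M => ‖Matrix.det M‖) hXeq
    simp only [Matrix.det_mul, norm_mul] at h1
    have h2 := RingHom.map_det (iterateFrobenius 𝕂 p e) X
    rw [RingHom.mapMatrix_apply] at h2
    rw [← h2, iterateFrobenius_def, ← hqpe, norm_pow, hΘ0, ← hPq] at h1
    have hXp : 0 < ‖X.det‖ := norm_pos_iff.mpr hXdet
    have h3 : ‖X.det‖ ^ q = ‖X.det‖ ^ (q - 1) * ‖X.det‖ := by
      rw [← pow_succ]; congr 1; omega
    rw [h3] at h1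
    have h4 := mul_right_cancel₀ hXp.ne' h1
    exact ((pow_left_inj₀ hPpos.le hXp.le (by omega)).mp h4).symm
  have hdetB0 : ‖PowerSeries.constantCoeff B.det‖ = P := by
    rw [RingHom.map_det, RingHom.mapMatrix_apply, hBX, hdetX]
  -- choice of the radius
  have hchain : ∀ j n, 1 ≤ n → n < N →
      ‖PowerSeries.coeff n (hPS 𝕂 q r N θ A (ξ j))‖ < ‖x j‖ := by
    intro j n hn1 hnN
    rw [coeff_hPS, if_pos hnN]
    have hne : ∀ i ≤ N - 1, (phiT 𝕂 q r θ A)^[i] (ξ j) ≠ 0 := by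
      intro i hi h0
      apply hx0 j
      rw [← (hξ j).2.2.1]
      have h1 : N - 1 = (N - 1 - i) + i := by omega
      rw [h1, Function.iterate_add_apply, h0]
      exact Function.iterate_fixed (phiT_zero q r (by omega) θ A) _
    have hstep : ∀ i, i + 1 ≤ N - 1 →
        ‖(phiT 𝕂 q r θ A)^[i] (ξ j)‖ < ‖(phiT 𝕂 q r θ A)^[i + 1] (ξ j)‖ := by
      intro i hi
      have h1 := (hξ j).2.2.2 i hi
      exact (Real.logb_lt_logb_iff hq1 (norm_pos_iff.mpr (hne i (by omega)))
        (norm_pos_iff.mpr (hne (i + 1) hi))).mp h1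
    have hind2 : ∀ k, 1 ≤ k → k ≤ N - 1 → ‖(phiT 𝕂 q r θ A)^[N - 1 - k] (ξ j)‖ < ‖x j‖ := by
      intro k
      induction k with
      | zero => intro h; omega
      | succ k ih =>
        intro _ hk
        have h1 := hstep (N - 1 - (k + 1)) (by omega)
        have h2 : N - 1 - (k + 1) + 1 = N - 1 - k := by omega
        rw [h2] at h1
        rcases Nat.eq_zero_or_pos k with h3 | h3
        · subst h3
          rw [Nat.sub_zero, (hξ j).2.2.1] at h1
          exact h1
        · exact h1.trans (ih h3 (by omega))
    exact hind2 n hn1 (by omega)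
  obtain ⟨s, hs1, hs⟩ := exists_s N (fun j => ‖x j‖)
    (fun j n => ‖PowerSeries.coeff n (hPS 𝕂 q r N θ A (ξ j))‖)
    (fun j => by
      rw [coeff_hPS, if_pos (by omega), Nat.sub_zero, (hξ j).2.2.1]) hchain
  have hs0 : 0 < s := by linarith
  have hBd : ∀ i j, Bd s (B i j) (‖x j‖ ^ q ^ (i : ℕ)) := by
    intro i j n
    rw [hB, BPS, Matrix.of_apply, twist, PowerSeries.coeff_mk]
    have hqi : 1 ≤ q ^ (i : ℕ) := Nat.one_le_pow _ _ (by omega)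
    rcases lt_or_ge n N with hn | hn
    · have h1 := hs j n hn
      rw [norm_pow]
      calc _ ≤ ‖PowerSeries.coeff n (hPS 𝕂 q r N θ A (ξ j))‖ ^ q ^ (i : ℕ) * (s ^ n) ^ q ^ (i : ℕ) :=
            mul_le_mul_of_nonneg_left
              (le_self_pow₀ (one_le_pow₀ hs1.le) (by omega)) (by positivity)
        _ = (‖PowerSeries.coeff n (hPS 𝕂 q r N θ A (ξ j))‖ * s ^ n) ^ q ^ (i : ℕ) :=
            (mul_pow _ _ _).symm
        _ ≤ _ := pow_le_pow_left₀ (by positivity) h1 _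
    · rw [coeff_hPS, if_neg (by omega), zero_pow (by omega), norm_zero, zero_mul]
      positivity
  have hdetBd : Bd s B.det P := by
    refine det_bd hs0 B P hPpos.le fun σ => ?_
    refine (Bd.prod hs0 _ _ _ fun i _ => hBd (σ i) i).mono ?_
    exact rearr hq.le _ hpos hmono σ
  have hinv : Bd s (B.det)⁻¹ P⁻¹ := Bd.inv hs0 hPpos hdetBd hdetB0
  -- adjugate bounds
  have hadj : ∀ j k, ∃ c, Bd s (B.adjugate j k) c := by
    intro j k
    rw [Matrix.adjugate_apply]
    set M := B.updateRow k (Pi.single j 1) with hM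
    have hMb : ∀ a b, ∃ c, Bd s (M a b) c := by
      intro a b
      by_cases h : a = k
      · subst h
        rw [hM, Matrix.updateRow_self, Pi.single_apply]
        split_ifs
        · exact ⟨_, by simpa using Bd.C (s := s) (1 : 𝕂)⟩
        · exact ⟨_, by simpa using Bd.C (s := s) (0 : 𝕂)⟩
      · rw [hM, Matrix.updateRow_ne h]
        exact ⟨_, hBd a b⟩
    choose c hc using hMb
    have hpr : ∀ σ : Equiv.Perm (Fin r), Bd s (∏ i, M (σ i) i) (∏ i, c (σ i) i) := fun σ =>
      Bd.prod hs0 _ _ _ fun i _ => hc (σ i) i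
    refine ⟨∑ σ : Equiv.Perm (Fin r), ∏ i, c (σ i) i, det_bd hs0 M _ ?_ fun σ => ?_⟩
    · exact Finset.sum_nonneg fun σ _ => (hpr σ).nonneg
    · exact (hpr σ).mono (Finset.single_le_sum (f := fun σ : Equiv.Perm (Fin r) => ∏ i, c (σ i) i)
        (fun τ _ => (hpr τ).nonneg) (Finset.mem_univ σ))
  have hadj0 : ∀ j, Bd s (B.adjugate j ⟨0, hr⟩) (P / ‖x ⟨0, hr⟩‖) := by
    intro j
    have hle : P / ‖x j‖ ≤ P / ‖x ⟨0, hr⟩‖ :=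
      div_le_div_of_nonneg_left hPpos.le (hpos _) (hmono (Fin.le_def.mpr (Nat.zero_le _)))
    refine Bd.mono ?_ hle
    rw [Matrix.adjugate_apply]
    refine det_bd hs0 _ _ (div_pos hPpos (hpos j)).le fun σ => ?_
    by_cases hσ : σ j = ⟨0, hr⟩
    · rw [← Finset.mul_prod_erase _ _ (Finset.mem_univ j), hσ, Matrix.updateRow_self,
        Pi.single_eq_same, one_mul]
      have h1 : Bd s (∏ i ∈ Finset.univ.erase j,
          (B.updateRow ⟨0, hr⟩ (Pi.single j 1)) (σ i) i)
          (∏ i ∈ Finset.univ.erase j, ‖x i‖ ^ q ^ (σ i : ℕ)) := by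
        refine Bd.prod hs0 _ _ _ fun i hi => ?_
        have hi' : σ i ≠ ⟨0, hr⟩ := by
          rw [← hσ]
          exact fun h => (Finset.ne_of_mem_erase hi) (σ.injective h)
        rw [Matrix.updateRow_ne hi']
        exact hBd (σ i) i
      refine h1.mono ?_
      rw [le_div_iff₀ (hpos j)]
      have h2 := rearr hq.le _ hpos hmono σ
      rw [← Finset.mul_prod_erase _ _ (Finset.mem_univ j), hσ] at h2
      simp only [pow_zero, pow_one] at h2
      rw [mul_comm]
      exact h2
    · have h1 : ∏ i, (B.updateRow ⟨0, hr⟩ (Pi.single j 1)) (σ i) i = 0 := by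
        refine Finset.prod_eq_zero (Finset.mem_univ (σ.symm ⟨0, hr⟩)) ?_
        rw [Equiv.apply_symm_apply, Matrix.updateRow_self, Pi.single_apply, if_neg]
        intro h
        exact hσ (by rw [← h, Equiv.apply_symm_apply])
      rw [h1]
      have h2 := (Bd.C (s := s) (0 : 𝕂)).mono (d := P / ‖x j‖)
        (by rw [norm_zero]; exact (div_pos hPpos (hpos j)).le)
      simpa using h2
  set C : Matrix (Fin r) (Fin r) (PowerSeries 𝕂) := (B.det)⁻¹ • B.adjugate with hC
  have hdne : PowerSeries.constantCoeff B.det ≠ 0 :=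
    norm_pos_iff.mp (by rw [hdetB0]; exact hPpos)
  have hBC : B * C = 1 := by
    rw [hC, Matrix.mul_smul, Matrix.mul_adjugate, smul_smul, PowerSeries.inv_mul_cancel _ hdne,
      one_smul]
  have hCB : C * B = 1 := by
    rw [hC, Matrix.smul_mul, Matrix.adjugate_mul, smul_smul, PowerSeries.inv_mul_cancel _ hdne,
      one_smul]
  refine ⟨⟨fun i j => (hBd i j).isTate hs1, C, ?_, hBC, hCB⟩, ?_⟩
  · intro i j
    obtain ⟨c, hc⟩ := hadj i j
    rw [hC, Matrix.smul_apply, smul_eq_mul]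
    exact (Bd.mul hs0 hinv hc).isTate hs1
  · rw [Matrix.inv_eq_right_inv hBC]
    set G : Matrix (Fin r) (Fin r) (PowerSeries 𝕂) := Matrix.of fun i k : Fin r =>
      if (i : ℕ) = 0 then
        PowerSeries.C (ξ k) * PowerSeries.X ^ N * (PowerSeries.X - PowerSeries.C θ)⁻¹ else 0 with hG
    have hΘu : IsUnit Θ.det := by
      rw [PowerSeries.isUnit_iff_constantCoeff, hΘdet]
      simp [hθ0, hAr]
    have htB : twistM 𝕂 q 1 B = Θ * (B - G) := by
      rw [Matrix.mul_sub, hΘB, hΘG, add_sub_cancel_right]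
    have hmain : C * Θ⁻¹ * twistM 𝕂 q 1 B - 1 = -(C * G) := by
      rw [htB, Matrix.mul_assoc, Matrix.nonsing_inv_mul_cancel_left _ _ hΘu, Matrix.mul_sub, hCB]
      abel
    rw [hmain]
    have hXθ : Bd 1 (PowerSeries.X - PowerSeries.C θ : PowerSeries 𝕂)⁻¹ (q : ℝ)⁻¹ := by
      refine Bd.inv one_pos hq0 ?_ (by simp [hθ])
      intro n
      rw [map_sub, PowerSeries.coeff_X, PowerSeries.coeff_C, one_pow, mul_one]
      split_ifs with h1 h2 h2
      · omega
      · simpa using hq1.le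
      · simp [hθ]
      · simp
    have hent : ∀ j k, gnorm 𝕂 ((-(C * G)) j k) < 1 := by
      intro j k
      have h1 : (C * G) j k = C j ⟨0, hr⟩ * G ⟨0, hr⟩ k := by
        rw [Matrix.mul_apply, Finset.sum_eq_single ⟨0, hr⟩]
        · intro i _ hi
          have : (i : ℕ) ≠ 0 := fun h => hi (Fin.ext h)
          simp [hG, this]
        · simp
      have h2 : Bd 1 ((C * G) j k)
          ((P⁻¹ * (P / ‖x ⟨0, hr⟩‖)) * ((‖ξ k‖ * 1) * (q : ℝ)⁻¹)) := by
        rw [h1]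
        refine Bd.mul one_pos ?_ ?_
        · rw [hC, Matrix.smul_apply, smul_eq_mul]
          exact (Bd.mul hs0 hinv (hadj0 j)).one_of hs1.le
        · simp only [hG, Matrix.of_apply, if_true]
          exact Bd.mul one_pos (Bd.mul one_pos (Bd.C _) (Bd.Xpow N)) hXθ
      rw [Matrix.neg_apply]
      refine h2.neg.gnorm_le.trans_lt ?_
      have h3 : ‖ξ k‖ < q * ‖x ⟨0, hr⟩‖ := (hξ k).2.1.trans_le hR
      have h4 := hpos ⟨0, hr⟩
      have h5 : (P⁻¹ * (P / ‖x ⟨0, hr⟩‖)) * ((‖ξ k‖ * 1) * (q : ℝ)⁻¹)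
          = ‖ξ k‖ / (q * ‖x ⟨0, hr⟩‖) := by
        field_simp
      rw [h5, div_lt_one (by positivity)]
      exact h3
    have : Nonempty (Fin r × Fin r) := ⟨(⟨0, hr⟩, ⟨0, hr⟩)⟩
    obtain ⟨⟨j, k⟩, hjk⟩ := exists_eq_ciSup_of_finite
      (f := fun pp : Fin r × Fin r => gnorm 𝕂 ((-(C * G)) pp.1 pp.2))
    rw [mnorm, ← hjk]
    exact hent j k

end DrinfeldRAT
end
end

section
/- Let φ be a Drinfeld module of rank r over 𝕂 given by φ_t = θ + A_1 τ + ⋯ + A_r τ^r. Then the radius of convergence of log_φ(z) is exactly R_φ; that is, min{|π| : π ∈ Λ_φ, π ≠ 0} = q^{−μ_m} = R_φ. -/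
open Filter

set_option maxHeartbeats 1000000
set_option synthInstance.maxHeartbeats 400000

noncomputable section

namespace DrinfeldRAT

variable (𝕂 : Type) [NontriviallyNormedField 𝕂]

theorem aux_norm_add {F : Type} [NontriviallyNormedField F]
    (hna : ∀ x y : F, ‖x + y‖ ≤ max ‖x‖ ‖y‖) (x y : F) (h : ‖y‖ < ‖x‖) : ‖x + y‖ = ‖x‖ := by
  apply le_antisymm
  · exact (hna x y).trans (by simp [h.le])
  · have h1 := hna (x + y) (-y)
    rw [add_neg_cancel_right, norm_neg] at h1
    rcases le_max_iff.1 h1 with h2 | h2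
    · exact h2
    · linarith

/-- A map close to the identity preserves norms on a small ball. -/
theorem aux_near_norm {F : Type} [NontriviallyNormedField F]
    (hna : ∀ x y : F, ‖x + y‖ ≤ max ‖x‖ ‖y‖) (g : F → F) (ρ : ℝ) (hρ : 0 < ρ)
    (hg : ∀ x, ‖x‖ ≤ ρ → ‖g x‖ ≤ ‖x‖ * (‖x‖ / ρ)) (x : F) (hx : ‖x‖ < ρ) :
    ‖x + g x‖ = ‖x‖ := by
  rcases eq_or_ne x 0 with rfl | h0
  · have := hg 0 (by simpa using hρ.le)
    simp at this
    simp [this]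
  · have hpos : 0 < ‖x‖ := norm_pos_iff.2 h0
    apply aux_norm_add hna
    refine (hg x hx.le).trans_lt ?_
    have : ‖x‖ / ρ < 1 := (div_lt_one hρ).2 hx
    nlinarith

/-- A map close to the identity is surjective on a small ball. -/
theorem aux_near_surj {F : Type} [NontriviallyNormedField F] [CompleteSpace F]
    (hna : ∀ x y : F, ‖x + y‖ ≤ max ‖x‖ ‖y‖) (g : F → F) (ρ : ℝ) (hρ : 0 < ρ)
    (hadd : ∀ x y, g (x - y) = g x - g y)
    (hg : ∀ x, ‖x‖ ≤ ρ → ‖g x‖ ≤ ‖x‖ * (‖x‖ / ρ)) (y : F) (hy : ‖y‖ < ρ) :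
    ∃ x, ‖x‖ = ‖y‖ ∧ x + g x = y := by
  set s : Set F := Metric.closedBall 0 ‖y‖ with hs
  have hmem : ∀ x, x ∈ s ↔ ‖x‖ ≤ ‖y‖ := by intro x; simp [hs]
  have hc1 : ‖y‖ / ρ < 1 := (div_lt_one hρ).2 hy
  have hc0 : 0 ≤ ‖y‖ / ρ := by positivity
  have hbd : ∀ x, ‖x‖ ≤ ‖y‖ → ‖g x‖ ≤ (‖y‖ / ρ) * ‖x‖ := by
    intro x hx
    refine (hg x (hx.trans hy.le)).trans ?_
    rw [mul_comm]
    gcongr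
  have hsub : ∀ x z : F, ‖x‖ ≤ ‖y‖ → ‖z‖ ≤ ‖y‖ → ‖x - z‖ ≤ ‖y‖ := by
    intro x z hx hz
    rw [sub_eq_add_neg]
    exact (hna _ _).trans (by simp [hx, hz])
  have hmaps : Set.MapsTo (fun x => y - g x) s s := by
    intro x hx
    rw [hmem] at hx ⊢
    apply hsub _ _ le_rfl
    refine (hbd x hx).trans ?_
    nlinarith [norm_nonneg x]
  have hcon : ContractingWith ⟨‖y‖ / ρ, hc0⟩ (hmaps.restrict (fun x => y - g x) s s) := by
    refine ⟨by exact_mod_cast hc1, ?_⟩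
    apply LipschitzWith.of_dist_le_mul
    rintro ⟨a, ha⟩ ⟨b, hb⟩
    rw [hmem] at ha hb
    simp only [Subtype.dist_eq, Set.MapsTo.val_restrict_apply, dist_eq_norm, NNReal.coe_mk]
    have : y - g a - (y - g b) = g (b - a) := by rw [hadd]; ring
    rw [this, norm_sub_rev a b]
    exact hbd _ (hsub _ _ hb ha)
  obtain ⟨x, hxs, hfix, -⟩ := ContractingWith.exists_fixedPoint' (Metric.isClosed_closedBall.isComplete)
    hmaps hcon (x := y) ((hmem y).2 le_rfl) (edist_ne_top _ _)
  have hxe : x + g x = y := by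
    have : y - g x = x := hfix
    linear_combination -this
  rw [hmem] at hxs
  refine ⟨x, ?_, hxe⟩
  rw [← aux_near_norm hna g ρ hρ hg x (hxs.trans_lt hy), hxe]

/-- If all roots have norm larger than `ρ`, the constant term strictly dominates. -/
theorem aux_prod {F : Type} [NontriviallyNormedField F]
    (hna : ∀ x y : F, ‖x + y‖ ≤ max ‖x‖ ‖y‖) (ρ : ℝ) (hρ : 0 < ρ) (s : Multiset F) :
    (∀ x ∈ s, ρ < ‖x‖) →
    0 < ‖((s.map fun x => Polynomial.X - Polynomial.C x).prod).coeff 0‖ ∧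
    ∀ k, ‖((s.map fun x => Polynomial.X - Polynomial.C x).prod).coeff (k + 1)‖ * ρ ^ (k + 1) <
      ‖((s.map fun x => Polynomial.X - Polynomial.C x).prod).coeff 0‖ := by
  induction s using Multiset.induction_on with
  | empty => intro _; simp [Polynomial.coeff_one]
  | cons a s ih =>
    intro h
    obtain ⟨h0, h1⟩ := ih (fun x hx => h x (Multiset.mem_cons_of_mem hx))
    have ha := h a (Multiset.mem_cons_self a s)
    have hapos : 0 < ‖a‖ := hρ.trans ha
    rw [Multiset.map_cons, Multiset.prod_cons]
    set Q := (s.map fun x => Polynomial.X - Polynomial.C x).prod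
    have hle : ∀ k, ‖Q.coeff k‖ * ρ ^ k ≤ ‖Q.coeff 0‖ := by
      intro k
      cases k with
      | zero => simp
      | succ k => exact (h1 k).le
    have hc0 : ((Polynomial.X - Polynomial.C a) * Q).coeff 0 = - (a * Q.coeff 0) := by
      simp [sub_mul, Polynomial.mul_coeff_zero]
    rw [hc0, norm_neg, norm_mul]
    refine ⟨by positivity, fun k => ?_⟩
    have hck : ((Polynomial.X - Polynomial.C a) * Q).coeff (k + 1)
        = Q.coeff k + -(a * Q.coeff (k + 1)) := by
      simp [sub_mul, Polynomial.coeff_X_mul]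
      ring
    rw [hck]
    have hp : 0 < ρ ^ (k + 1) := by positivity
    have := hna (Q.coeff k) (-(a * Q.coeff (k + 1)))
    rw [norm_neg, norm_mul] at this
    rcases le_max_iff.1 this with h2 | h2
    · calc _ ≤ ‖Q.coeff k‖ * ρ ^ (k + 1) := by gcongr
        _ = (‖Q.coeff k‖ * ρ ^ k) * ρ := by ring
        _ ≤ ‖Q.coeff 0‖ * ρ := by gcongr; exact hle k
        _ < ‖Q.coeff 0‖ * ‖a‖ := by gcongr
        _ = _ := by ring
    · calc _ ≤ (‖a‖ * ‖Q.coeff (k + 1)‖) * ρ ^ (k + 1) := by gcongr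
        _ = ‖a‖ * (‖Q.coeff (k + 1)‖ * ρ ^ (k + 1)) := by ring
        _ < ‖a‖ * ‖Q.coeff 0‖ := by gcongr; exact h1 k

theorem aux_roots {F : Type} [NontriviallyNormedField F] [IsAlgClosed F]
    (hna : ∀ x y : F, ‖x + y‖ ≤ max ‖x‖ ‖y‖) (ρ : ℝ) (hρ : 0 < ρ) (P : Polynomial F)
    (hP : P ≠ 0) (h : ∀ x, P.eval x = 0 → ρ < ‖x‖) (k : ℕ) :
    ‖P.coeff (k + 1)‖ * ρ ^ (k + 1) < ‖P.coeff 0‖ := by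
  have hs := (IsAlgClosed.splits P).eq_prod_roots
  obtain ⟨-, h1⟩ := aux_prod hna ρ hρ P.roots (fun x hx => h x (Polynomial.isRoot_of_mem_roots hx))
  have hl : 0 < ‖P.leadingCoeff‖ := norm_pos_iff.2 (Polynomial.leadingCoeff_ne_zero.2 hP)
  rw [hs, Polynomial.coeff_C_mul, Polynomial.coeff_C_mul, norm_mul, norm_mul, mul_assoc]
  gcongr
  exact h1 k

/-- The real-exponent bookkeeping. -/
theorem aux_mu {F : Type} [NontriviallyNormedField F] (q r : ℕ) (hq : 2 ≤ q) (A : ℕ → F) (m : ℕ)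
    (i : ℕ) (hi : 1 ≤ i) (hA : A i ≠ 0) (hle : muPhi F q A i ≤ muPhi F q A m) :
    ‖A i‖ * (Rphi F q A m / q) ^ q ^ i ≤ Rphi F q A m ∧
    (i = m → ‖A i‖ * (Rphi F q A m / q) ^ q ^ i = Rphi F q A m) := by
  have hq0 : (0 : ℝ) < q := by positivity
  have hq1 : (1 : ℝ) < q := by exact_mod_cast hq
  have hqi : (1 : ℝ) < (q : ℝ) ^ i := one_lt_pow₀ hq1 (by omega)
  have hdeg : degK F q (A i) = muPhi F q A i * ((q : ℝ) ^ i - 1) + (q : ℝ) ^ i := by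
    unfold muPhi
    rw [div_mul_cancel₀ _ (by linarith)]
    ring
  have hnorm : ‖A i‖ = (q : ℝ) ^ (degK F q (A i)) := by
    unfold degK
    rw [Real.rpow_logb hq0 (by linarith) (norm_pos_iff.2 hA)]
  have key : ‖A i‖ * (Rphi F q A m / q) ^ q ^ i
      = (q : ℝ) ^ ((muPhi F q A i - muPhi F q A m) * ((q : ℝ) ^ i - 1) - muPhi F q A m) := by
    have h1 : Rphi F q A m / q = (q : ℝ) ^ (-(muPhi F q A m) - 1) := by
      unfold Rphi
      rw [Real.rpow_sub hq0, Real.rpow_one]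
    rw [h1, ← Real.rpow_natCast, ← Real.rpow_mul hq0.le, hnorm, ← Real.rpow_add hq0, hdeg]
    congr 1
    push_cast
    ring
  rw [key]
  constructor
  · unfold Rphi
    apply Real.rpow_le_rpow_of_exponent_le hq1.le
    nlinarith
  · rintro rfl
    unfold Rphi
    simp

theorem aux_pow_sub {F : Type} [Field F] (p e q : ℕ) (hp : p.Prime) (hcharp : CharP F p)
    (hqpe : q = p ^ e) (x y : F) (n : ℕ) : (x - y) ^ q ^ n = x ^ q ^ n - y ^ q ^ n := by
  haveI := Fact.mk hp
  rw [hqpe, ← pow_mul]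
  exact sub_pow_char_pow x y (e * n)

theorem stmt4
    (𝕂 : Type) [NontriviallyNormedField 𝕂] [CompleteSpace 𝕂] [IsAlgClosed 𝕂]
    (hna : ∀ x y : 𝕂, ‖x + y‖ ≤ max ‖x‖ ‖y‖)
    (p e q : ℕ) (hp : p.Prime) (hcharp : CharP 𝕂 p) (he : 0 < e) (hqpe : q = p ^ e)
    (θ : 𝕂) (hθ : ‖θ‖ = (q : ℝ))
    (r : ℕ) (hr : 0 < r) (A : ℕ → 𝕂) (hAr : A r ≠ 0)
    (m : ℕ) (hm : IsMuIndex 𝕂 q r A m)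
    (α : ℕ → 𝕂) (hα0 : α 0 = 1)
    (hαsum : ∀ z : 𝕂, Summable fun n => α n * z ^ q ^ n)
    (hαFE : ∀ z : 𝕂, expF 𝕂 q α (θ * z) = phiT 𝕂 q r θ A (expF 𝕂 q α z))
    :
    IsLeast {x : ℝ | ∃ z : 𝕂, expF 𝕂 q α z = 0 ∧ z ≠ 0 ∧ ‖z‖ = x} (Rphi 𝕂 q A m) := by
  have hq : 2 ≤ q := by
    rw [hqpe]
    exact hp.two_le.trans (Nat.le_self_pow he.ne' p)
  have hq0 : (0 : ℝ) < q := by positivity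
  have hq1 : (1 : ℝ) < q := by exact_mod_cast hq
  have hθ0 : θ ≠ 0 := by
    rw [← norm_pos_iff, hθ]; exact hq0
  haveI : IsUltrametricDist 𝕂 := IsUltrametricDist.isUltrametricDist_of_forall_norm_add_le_max_norm hna
  obtain ⟨⟨hm1, hmr, hAm⟩, hmax, -⟩ := hm
  set R := Rphi 𝕂 q A m with hR
  have hR0 : 0 < R := Real.rpow_pos_of_pos hq0 _
  set ρ := R / q with hρdef
  have hρ : 0 < ρ := by positivity
  have hqρ : q * ρ = R := by rw [hρdef]; field_simp
  have hA : ∀ i ∈ Finset.Icc 1 r, ‖A i‖ * ρ ^ q ^ i ≤ R := by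
    intro i hi
    rw [Finset.mem_Icc] at hi
    by_cases h0 : A i = 0
    · simp [h0, hR0.le]
    · exact (aux_mu q r hq A m i hi.1 h0 (hmax i ⟨hi.1, hi.2, h0⟩)).1
  have hAmeq : ‖A m‖ * ρ ^ q ^ m = R := (aux_mu q r hq A m m hm1 hAm le_rfl).2 rfl
  -- power comparison
  have hpow2 : ∀ (u : ℝ) (n : ℕ), 0 ≤ u → u ≤ 1 → 1 ≤ n → u ^ q ^ n ≤ u ^ 2 := by
    intro u n h0 h1 hn
    apply pow_le_pow_of_le_one h0 h1
    exact hq.trans (Nat.le_self_pow (by omega) q)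
  -- the map `g` for `φ_t`
  set g : 𝕂 → 𝕂 := fun x => θ⁻¹ * ∑ i ∈ Finset.Icc 1 r, A i * x ^ q ^ i with hgdef
  have hphi : ∀ x, phiT 𝕂 q r θ A x = θ * (x + g x) := by
    intro x
    simp only [phiT, hgdef, mul_add, mul_inv_cancel_left₀ hθ0]
  have hgsub : ∀ x y, g (x - y) = g x - g y := by
    intro x y
    simp only [hgdef, aux_pow_sub p e q hp hcharp hqpe, mul_sub, Finset.sum_sub_distrib]
  have hgb : ∀ x, ‖x‖ ≤ ρ → ‖g x‖ ≤ ‖x‖ * (‖x‖ / ρ) := by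
    intro x hx
    have hu1 : ‖x‖ / ρ ≤ 1 := (div_le_one hρ).2 hx
    have hu0 : 0 ≤ ‖x‖ / ρ := by positivity
    have hsum : ‖∑ i ∈ Finset.Icc 1 r, A i * x ^ q ^ i‖ ≤ R * (‖x‖ / ρ) ^ 2 := by
      apply IsUltrametricDist.norm_sum_le_of_forall_le_of_nonneg (by positivity)
      intro i hi
      have h1 := hA i hi
      rw [norm_mul, norm_pow]
      calc ‖A i‖ * ‖x‖ ^ q ^ i = (‖A i‖ * ρ ^ q ^ i) * (‖x‖ / ρ) ^ q ^ i := by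
            rw [mul_assoc, ← mul_pow, mul_div_cancel₀ _ hρ.ne']
        _ ≤ R * (‖x‖ / ρ) ^ 2 := by
            exact mul_le_mul h1 (hpow2 _ i hu0 hu1 (Finset.mem_Icc.1 hi).1) (by positivity) hR0.le
    simp only [hgdef]
    rw [norm_mul, norm_inv, hθ]
    calc (q : ℝ)⁻¹ * ‖∑ i ∈ Finset.Icc 1 r, A i * x ^ q ^ i‖ ≤ (q : ℝ)⁻¹ * (R * (‖x‖ / ρ) ^ 2) := by
          gcongr
      _ = ‖x‖ * (‖x‖ / ρ) := by rw [← hqρ]; field_simp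
  have hphin : ∀ x, ‖x‖ < ρ → ‖phiT 𝕂 q r θ A x‖ = q * ‖x‖ := by
    intro x hx
    rw [hphi, norm_mul, hθ, aux_near_norm hna g ρ hρ hgb x hx]
  have hphis : ∀ y, ‖y‖ < R → ∃ x, ‖x‖ = ‖y‖ / q ∧ phiT 𝕂 q r θ A x = y := by
    intro y hy
    have h1 : ‖θ⁻¹ * y‖ = ‖y‖ / q := by
      rw [norm_mul, norm_inv, hθ]; field_simp
    obtain ⟨x, hx, hxe⟩ := aux_near_surj hna g ρ hρ hgsub hgb (θ⁻¹ * y) (by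
      rw [h1, hρdef]; gcongr)
    refine ⟨x, hx.trans h1, ?_⟩
    rw [hphi, hxe, mul_inv_cancel_left₀ hθ0]
  -- the exponential near zero
  set E := expF 𝕂 q α with hE
  have hEsub : ∀ x y, E (x - y) = E x - E y := by
    intro x y
    simp only [hE, expF, aux_pow_sub p e q hp hcharp hqpe, mul_sub]
    exact (hαsum x).tsum_sub (hαsum y)
  obtain ⟨C, hC⟩ : ∃ C : ℝ, ∀ n, ‖α n‖ ≤ C := by
    have h1 := (hαsum 1).tendsto_atTop_zero.norm
    simp only [one_pow, mul_one] at h1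
    obtain ⟨C, hC⟩ := h1.bddAbove_range
    exact ⟨C, fun n => hC ⟨n, rfl⟩⟩
  have hC1 : 1 ≤ C := by simpa [hα0] using hC 0
  have hC0 : 0 < C := by linarith
  set δ := C⁻¹ with hδdef
  have hδ : 0 < δ := by positivity
  have hδ1 : δ ≤ 1 := inv_le_one_of_one_le₀ hC1
  have hEg : ∀ x, ‖x‖ ≤ δ → ‖E x - x‖ ≤ ‖x‖ * (‖x‖ / δ) := by
    intro x hx
    have h1 : E x - x = ∑' n, α (n + 1) * x ^ q ^ (n + 1) := by
      simp only [hE, expF]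
      rw [(hαsum x).tsum_eq_zero_add]
      simp [hα0]
    rw [h1]
    apply IsUltrametricDist.norm_tsum_le_of_forall_le_of_nonneg (by positivity)
    intro n
    rw [norm_mul, norm_pow]
    calc ‖α (n + 1)‖ * ‖x‖ ^ q ^ (n + 1) ≤ C * ‖x‖ ^ 2 := by
          exact mul_le_mul (hC _) (hpow2 _ _ (norm_nonneg x) (hx.trans hδ1) (by omega))
            (by positivity) hC0.le
      _ = ‖x‖ * (‖x‖ / δ) := by rw [hδdef]; field_simp
  have hEsub2 : ∀ x y, (fun x => E x - x) (x - y) = (fun x => E x - x) x - (fun x => E x - x) y := by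
    intro x y
    simp only [hEsub]; ring
  have hθz : ∀ z, ‖θ⁻¹ * z‖ = ‖z‖ / q := by
    intro z
    rw [norm_mul, norm_inv, hθ]; field_simp
  -- norm preservation on the ball of radius R
  have hiso : ∀ n : ℕ, ∀ z, ‖z‖ < R → ‖z‖ < δ * q ^ n → ‖E z‖ = ‖z‖ := by
    intro n
    induction n with
    | zero =>
      intro z _ hz
      have := aux_near_norm hna (fun x => E x - x) δ hδ hEg z (by simpa using hz)
      simpa using this
    | succ n ih =>
      intro z hz hzn
      have h1 := ih (θ⁻¹ * z) (by
        rw [hθz]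
        refine lt_of_le_of_lt (div_le_self (norm_nonneg z) hq1.le) hz) (by
        rw [hθz, div_lt_iff₀ hq0, mul_assoc, ← pow_succ]; exact hzn)
      have h2 : E z = phiT 𝕂 q r θ A (E (θ⁻¹ * z)) := by
        rw [← hαFE, mul_inv_cancel_left₀ hθ0]
      rw [h2, hphin _ (by rw [h1, hθz, hρdef]; gcongr), h1, hθz]
      field_simp
  have hsurj : ∀ n : ℕ, ∀ y, ‖y‖ < R → ‖y‖ < δ * q ^ n → ∃ z, ‖z‖ = ‖y‖ ∧ E z = y := by
    intro n
    induction n with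
    | zero =>
      intro y _ hy
      obtain ⟨z, hz, hze⟩ := aux_near_surj hna (fun x => E x - x) δ hδ hEsub2 hEg y
        (by simpa using hy)
      exact ⟨z, hz, by simpa using hze⟩
    | succ n ih =>
      intro y hy hyn
      obtain ⟨x, hx, hxe⟩ := hphis y hy
      obtain ⟨z, hz, hze⟩ := ih x (by
        rw [hx]
        exact lt_of_le_of_lt (div_le_self (norm_nonneg y) hq1.le) hy) (by
        rw [hx, div_lt_iff₀ hq0, mul_assoc, ← pow_succ]; exact hyn)
      refine ⟨θ * z, ?_, ?_⟩
      · rw [norm_mul, hθ, hz, hx]; field_simp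
      · rw [hαFE, hze, hxe]
  have harch : ∀ u : ℝ, ∃ n : ℕ, u < δ * q ^ n := by
    intro u
    obtain ⟨n, hn⟩ := pow_unbounded_of_one_lt (u / δ) hq1
    exact ⟨n, by rwa [div_lt_iff₀' hδ] at hn⟩
  constructor
  · -- a root of `φ_t` of norm `ρ`
    obtain ⟨x, hx0, hxn⟩ : ∃ x, phiT 𝕂 q r θ A x = 0 ∧ ‖x‖ = ρ := by
      by_contra! hcon
      set P : Polynomial 𝕂 := Polynomial.C θ +
        ∑ i ∈ Finset.Icc 1 r, Polynomial.C (A i) * Polynomial.X ^ (q ^ i - 1) with hPdef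
      have hqi : ∀ i, 1 ≤ i → 2 ≤ q ^ i := fun i hi => hq.trans (Nat.le_self_pow (by omega) q)
      have hP0 : P.coeff 0 = θ := by
        simp only [hPdef, Polynomial.coeff_add, Polynomial.coeff_C_zero, Polynomial.finset_sum_coeff,
          Polynomial.coeff_C_mul, Polynomial.coeff_X_pow]
        rw [Finset.sum_eq_zero, add_zero]
        intro i hi
        have := hqi i (Finset.mem_Icc.1 hi).1
        rw [if_neg (by omega), mul_zero]
      have hPm : P.coeff (q ^ m - 2 + 1) = A m := by
        simp only [hPdef, Polynomial.coeff_add, Polynomial.finset_sum_coeff, Polynomial.coeff_C_succ,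
          Polynomial.coeff_C_mul, Polynomial.coeff_X_pow]
        rw [Finset.sum_eq_single m]
        · have := hqi m hm1
          rw [if_pos (by omega)]; simp
        · intro i hi him
          have h1 := hqi i (Finset.mem_Icc.1 hi).1
          have h2 := hqi m hm1
          rw [if_neg, mul_zero]
          intro h3
          exact him (Nat.pow_right_injective hq (show q ^ i = q ^ m by omega))
        · intro hmm
          exact absurd (Finset.mem_Icc.2 ⟨hm1, hmr⟩) hmm
      have hPne : P ≠ 0 := by
        intro h; rw [h] at hP0; exact hθ0 (by simpa using hP0.symm)
      have hPphi : ∀ x, phiT 𝕂 q r θ A x = x * P.eval x := by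
        intro x
        simp only [hPdef, phiT, Polynomial.eval_add, Polynomial.eval_C, Polynomial.eval_finset_sum,
          Polynomial.eval_mul, Polynomial.eval_pow, Polynomial.eval_X, mul_add, Finset.mul_sum]
        congr 1
        · ring
        · apply Finset.sum_congr rfl
          intro i hi
          have h1 := hqi i (Finset.mem_Icc.1 hi).1
          have : x ^ q ^ i = x * x ^ (q ^ i - 1) := by
            rw [← pow_succ']; congr 1; omega
          rw [this]; ring
      have hroots : ∀ x, P.eval x = 0 → ρ < ‖x‖ := by
        intro x hx
        have h1 : phiT 𝕂 q r θ A x = 0 := by rw [hPphi, hx, mul_zero]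
        have h2 := hcon x h1
        by_contra! h3
        have h4 := hphin x (lt_of_le_of_ne h3 h2)
        rw [h1, norm_zero] at h4
        have h5 : x = 0 := by
          rcases mul_eq_zero.1 h4.symm with h | h
          · exact absurd h hq0.ne'
          · exact norm_eq_zero.1 h
        rw [h5, ← Polynomial.coeff_zero_eq_eval_zero, hP0] at hx
        exact hθ0 hx
      have hfin := aux_roots hna ρ hρ P hPne hroots (q ^ m - 2)
      rw [hPm, hP0, hθ] at hfin
      have h6 : ρ ^ q ^ m = ρ ^ (q ^ m - 2 + 1) * ρ := by
        rw [← pow_succ]; congr 1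
        have := hqi m hm1
        omega
      rw [h6, ← hqρ, ← mul_assoc] at hAmeq
      have := mul_right_cancel₀ hρ.ne' hAmeq
      linarith
    have hρR : ρ < R := by rw [hρdef]; exact div_lt_self hR0 hq1
    obtain ⟨n, hn⟩ := harch ‖x‖
    obtain ⟨z, hz, hze⟩ := hsurj n x (by rw [hxn]; exact hρR) hn
    refine ⟨θ * z, ?_, ?_, ?_⟩
    · rw [hαFE]
      exact (congrArg _ hze).trans hx0
    · apply mul_ne_zero hθ0
      rw [← norm_pos_iff, hz, hxn]; exact hρ
    · rw [norm_mul, hθ, hz, hxn, hqρ]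
  · rintro _ ⟨z, hz, hz0, rfl⟩
    by_contra! hlt
    obtain ⟨n, hn⟩ := harch ‖z‖
    have h1 := hiso n z hlt hn
    rw [show E z = 0 from hz, norm_zero] at h1
    exact hz0 (norm_eq_zero.1 h1.symm)

end DrinfeldRAT
end
end
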